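/- Let n ≥ 2 and 1 ≤ k ≤ n−1 be integers, let p = 2k, and let γ be a constant with 0 < γ < C(n,k)/2^k. Then the equation σ_k(A[φ]) = φ^{p−k} γ on 𝕊ⁿ has a unique even, uniformly h-convex solution, and this solution is a constant φ = c > 1. -/

import Mathlib

open scoped RealInnerProductSpace
open Finset

noncomputable section

/-- Euclidean space `ℝ^(n+1)`, the ambient space of the unit sphere `𝕊ⁿ`. -/
abbrev Euc (n : ℕ) : Type := EuclideanSpace ℝ (Fin (n + 1))

/-- The unit sphere `𝕊ⁿ ⊆ ℝ^(n+1)`. -/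
def uSphere (n : ℕ) : Set (Euc n) := Metric.sphere (0 : Euc n) 1

/-- Orthogonal projection onto the tangent space of the sphere at (the normalization of) `x`. -/
def tanProj {n : ℕ} (x v : Euc n) : Euc n := v - (⟪x, v⟫ / ‖x‖ ^ 2) • x

/-- `f` is (the 0-homogeneous extension of) a function on the sphere. -/
def Homog0 {n : ℕ} (f : Euc n → ℝ) : Prop := ∀ (c : ℝ) (y : Euc n), 0 < c → f (c • y) = f y

/-- Smoothness of a function on the sphere, expressed via its 0-homogeneous extension. -/
def SmoothFn {n : ℕ} (f : Euc n → ℝ) : Prop := ContDiffOn ℝ (⊤ : ℕ∞) f {y : Euc n | y ≠ 0}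

/-- `f(x) = f(-x)` for all `x`. -/
def EvenFn {n : ℕ} (f : Euc n → ℝ) : Prop := ∀ y, f (-y) = f y

/-- Covariant (tangential) derivative of a function on the sphere, in direction `v`. -/
def covD {n : ℕ} (f : Euc n → ℝ) (x v : Euc n) : ℝ := fderiv ℝ f x (tanProj x v)

/-- Spherical (tangential) gradient. -/
def gradS {n : ℕ} (f : Euc n → ℝ) (x : Euc n) : Euc n := tanProj x (gradient f x)

/-- Covariant Hessian `(D²f)(v,w)` of a function on the round sphere. -/
def hessS {n : ℕ} (f : Euc n → ℝ) (x v w : Euc n) : ℝ :=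
  fderiv ℝ (fun y => covD f y w) x (tanProj x v)

/-- The symmetric 2-tensor
`A[φ](v,w) = (D²φ)(v,w) - (|Dφ|²/(2φ)) σ(v,w) + ((φ - 1/φ)/2) σ(v,w)` on the sphere. -/
def Aform {n : ℕ} (φ : Euc n → ℝ) (x v w : Euc n) : ℝ :=
  hessS φ x v w +
    ((φ x - (φ x)⁻¹) / 2 - ‖gradS φ x‖ ^ 2 / (2 * φ x)) * ⟪tanProj x v, tanProj x w⟫

/-- `φ` is h-convex: `A[φ] ≥ 0` on the sphere. -/
def HConvex {n : ℕ} (φ : Euc n → ℝ) : Prop :=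
  ∀ x ∈ uSphere n, ∀ v : Euc n, ⟪x, v⟫ = 0 → 0 ≤ Aform φ x v v

/-- `φ` is uniformly h-convex: `A[φ] > 0` on the sphere. -/
def UnifHConvex {n : ℕ} (φ : Euc n → ℝ) : Prop :=
  ∀ x ∈ uSphere n, ∀ v : Euc n, ⟪x, v⟫ = 0 → v ≠ 0 → 0 < Aform φ x v v

/-- `σ_k` of a square matrix: the sum of its principal `k × k` minors
(equivalently, the `k`-th elementary symmetric function of its eigenvalues). -/
def sigmaMat {N : ℕ} (k : ℕ) (M : Matrix (Fin N) (Fin N) ℝ) : ℝ :=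
  ∑ s ∈ Finset.powersetCard k (Finset.univ : Finset (Fin N)),
    Matrix.det (Matrix.of fun i j : {a : Fin N // a ∈ s} => M i.1 j.1)

/-- `e` is an orthonormal frame of the tangent space of `𝕊ⁿ` at `x`. -/
def OrthoFrame {n : ℕ} (x : Euc n) (e : Fin n → Euc n) : Prop :=
  (∀ i, ⟪x, e i⟫ = 0) ∧ ∀ i j, ⟪e i, e j⟫ = if i = j then 1 else 0

/-- The matrix of `A[φ]` at `x` with respect to an orthonormal tangent frame `e`. -/
def Amat {n : ℕ} (φ : Euc n → ℝ) (x : Euc n) (e : Fin n → Euc n) : Matrix (Fin n) (Fin n) ℝ :=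
  Matrix.of fun i j => Aform φ x (e i) (e j)

/-- `φ` solves the horospherical `p`-Christoffel-Minkowski equation
`σ_k(A[φ]) = φ^(p-k) f` on `𝕊ⁿ`. -/
def SolvesCM (n k : ℕ) (p : ℝ) (f φ : Euc n → ℝ) : Prop :=
  ∀ x ∈ uSphere n, ∀ e : Fin n → Euc n, OrthoFrame x e →
    sigmaMat k (Amat φ x e) = φ x ^ (p - (k : ℝ)) * f x

/-- Supremum (maximum) of a function over the sphere. -/
def sphSup {n : ℕ} (f : Euc n → ℝ) : ℝ := sSup (f '' uSphere n)

/-- Infimum (minimum) of a function over the sphere. -/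
def sphInf {n : ℕ} (f : Euc n → ℝ) : ℝ := sInf (f '' uSphere n)

/-- The function `f^(-1/q)`. -/
def negPowExt {n : ℕ} (f : Euc n → ℝ) (q : ℝ) : Euc n → ℝ := fun y => f y ^ (-(1 / q))

/-- Assumption 1.3 of the paper (Assumption (A)): the gradient-and-Hessian conditions on the
prescribed function `f`, according to the value of `p`. -/
def AssumptionA (n k : ℕ) (p : ℝ) (f : Euc n → ℝ) : Prop :=
  ((p = 0) →
    ∀ x ∈ uSphere n, ∀ v : Euc n, ⟪x, v⟫ = 0 →
      0 ≤ hessS (negPowExt f (k : ℝ)) x v v - ‖gradS (negPowExt f (k : ℝ)) x‖ * ‖v‖ ^ 2 +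
          negPowExt f (k : ℝ) x /
              (2 + 8 * sphSup fun y => (f y / (n.choose k : ℝ)) ^ (1 / (k : ℝ))) * ‖v‖ ^ 2) ∧
  ((0 < p ∧ p ≤ (k : ℝ) / 2) →
    ∀ x ∈ uSphere n, ∀ v : Euc n, ⟪x, v⟫ = 0 →
      0 ≤ hessS (negPowExt f (k : ℝ)) x v v -
            (((k : ℝ) + 2 * p) / (k : ℝ)) * ‖gradS (negPowExt f (k : ℝ)) x‖ * ‖v‖ ^ 2 +
          (p ^ 2 / (k : ℝ) ^ 2) * negPowExt f (k : ℝ) x * ‖v‖ ^ 2) ∧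
  (((k : ℝ) / 2 < p ∧ p < (k : ℝ)) →
    ∀ x ∈ uSphere n, ∀ v : Euc n, ⟪x, v⟫ = 0 →
      0 ≤ hessS (negPowExt f (k : ℝ)) x v v -
            ((3 * (k : ℝ) - 2 * p) ^ 2 / (p * (2 * p - (k : ℝ)))) *
              (‖gradS (negPowExt f (k : ℝ)) x‖ ^ 2 / (2 * negPowExt f (k : ℝ) x)) * ‖v‖ ^ 2 +
          (p / (2 * (k : ℝ))) * negPowExt f (k : ℝ) x * ‖v‖ ^ 2) ∧
  (((k : ℝ) ≤ p ∧ p < 2 * (k : ℝ)) →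
    ∀ x ∈ uSphere n, ∀ v : Euc n, ⟪x, v⟫ = 0 →
      0 ≤ hessS (negPowExt f p) x v v -
            (‖gradS (negPowExt f p) x‖ ^ 2 / (2 * negPowExt f p x)) * ‖v‖ ^ 2 +
          (1 / 2) * negPowExt f p x * ‖v‖ ^ 2) ∧
  ((p = 2 * (k : ℝ)) →
    sphSup f < (n.choose k : ℝ) / 2 ^ k ∧
    ∀ x ∈ uSphere n, ∀ v : Euc n, ⟪x, v⟫ = 0 →
      0 ≤ hessS (negPowExt f p) x v v -
            (‖gradS (negPowExt f p) x‖ ^ 2 / (2 * negPowExt f p x)) * ‖v‖ ^ 2 +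
          (1 / 2) * negPowExt f p x * ‖v‖ ^ 2) ∧
  ((2 * (k : ℝ) < p) →
    2 ≤ k ∧
    sphInf f ≤
      (k : ℝ) ^ k * (p - 2 * (k : ℝ)) ^ ((p - 2 * (k : ℝ)) / 2) / p ^ (p / 2) * (n.choose k : ℝ) ∧
    ∀ x ∈ uSphere n, ∀ v : Euc n, ⟪x, v⟫ = 0 →
      0 ≤ hessS (negPowExt f p) x v v -
            (‖gradS (negPowExt f p) x‖ ^ 2 / (2 * negPowExt f p x)) * ‖v‖ ^ 2 +
          ((k : ℝ) / p) * negPowExt f p x * ‖v‖ ^ 2)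

section Divergence

variable {E : Type*} [NormedAddCommGroup E] [InnerProductSpace ℝ E]

/-- The divergence of a vector field. -/
def dvg (Z : E → E) (y : E) : ℝ := LinearMap.trace ℝ E (fderiv ℝ Z y : E →ₗ[ℝ] E)

/-- Euler's relation for functions that are homogeneous along rays. -/
theorem fderiv_apply_self_of_homogeneous {F : Type*} [NormedAddCommGroup F] [NormedSpace ℝ F]
    {f : E → F} {r : ℝ → ℝ} {r' : ℝ} {y : E} (hf : DifferentiableAt ℝ f y)
    (hr : HasDerivAt r r' 1) (h : ∀ c : ℝ, 0 < c → f (c • y) = r c • f y) :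
    fderiv ℝ f y y = r' • f y := by
  have h1 : HasDerivAt (fun c : ℝ => f (c • y)) (fderiv ℝ f y y) 1 := by
    have h2 : HasDerivAt (fun c : ℝ => c • y) ((1 : ℝ) • y) 1 :=
      (hasDerivAt_id (1 : ℝ)).smul_const y
    rw [one_smul] at h2
    have hf' : HasFDerivAt f (fderiv ℝ f y) ((1 : ℝ) • y) := by
      rw [one_smul]; exact hf.hasFDerivAt
    exact hf'.comp_hasDerivAt (1 : ℝ) h2
  have h3 : HasDerivAt (fun c : ℝ => f (c • y)) (r' • f y) 1 := by
    refine (hr.smul_const (f y)).congr_of_eventuallyEq ?_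
    filter_upwards [lt_mem_nhds (zero_lt_one (α := ℝ))] with c hc using h c hc
  exact h1.unique h3

/-- The derivative of a homogeneous function is homogeneous, of one degree less. -/
theorem fderiv_smul_of_homogeneous {F : Type*} [NormedAddCommGroup F] [NormedSpace ℝ F]
    {f : E → F} {c r : ℝ} (hc : c ≠ 0) (h : ∀ y, f (c • y) = r • f y) (y : E) :
    fderiv ℝ f (c • y) = (r / c) • fderiv ℝ f y := by
  have h1 : fderiv ℝ (fun y => f (c • y)) y = c • fderiv ℝ f (c • y) := fderiv_comp_smul c
  have h2 : fderiv ℝ (fun y => f (c • y)) y = r • fderiv ℝ f y := by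
    simp_rw [h]
    exact congrFun (fderiv_const_smul_field (𝕜 := ℝ) (f := f) r) y
  rw [h1] at h2
  rw [div_eq_inv_mul, mul_smul, ← h2, inv_smul_smul₀ hc]

/-- The integral of the divergence of a compactly supported vector field vanishes. -/
theorem integral_dvg_eq_zero [FiniteDimensional ℝ E] [MeasurableSpace E] [BorelSpace E] {F : E → E}
    (hF : ContDiff ℝ 1 F) (hc : HasCompactSupport F) : ∫ y, dvg F y = 0 := by
  have hd : Differentiable ℝ F := hF.differentiable one_ne_zero
  have hF' : Continuous (fderiv ℝ F) := hF.continuous_fderiv one_ne_zero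
  let b := stdOrthonormalBasis ℝ E
  have key : ∀ v w : E, MeasureTheory.Integrable (fun y => ⟪v, fderiv ℝ F y w⟫) ∧
      ∫ y, ⟪v, fderiv ℝ F y w⟫ = 0 := by
    intro v w
    have hderiv : ∀ y, fderiv ℝ (fun y => ⟪v, F y⟫) y w = ⟪v, fderiv ℝ F y w⟫ := by
      intro y
      have := ((innerSL ℝ v).hasFDerivAt.comp y (hd y).hasFDerivAt).fderiv
      exact congrArg (fun L : E →L[ℝ] ℝ => L w) this
    have hcs : HasCompactSupport (fun y => ⟪v, F y⟫) :=
      hc.comp_left (g := fun u => ⟪v, u⟫) (inner_zero_right v)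
    have hcs' : HasCompactSupport (fun y => ⟪v, fderiv ℝ F y w⟫) :=
      (hc.fderiv ℝ).comp_left (g := fun L : E →L[ℝ] E => ⟪v, L w⟫) (by simp)
    have hcont : Continuous (fun y => ⟪v, fderiv ℝ F y w⟫) := by fun_prop
    have hi : MeasureTheory.Integrable (fun y => ⟪v, fderiv ℝ F y w⟫) :=
      hcont.integrable_of_hasCompactSupport hcs'
    have hcF : Continuous F := hF.continuous
    have hi0 : MeasureTheory.Integrable (fun y => ⟪v, F y⟫) :=
      Continuous.integrable_of_hasCompactSupport (by fun_prop) hcs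
    refine ⟨hi, ?_⟩
    have := integral_mul_fderiv_eq_neg_fderiv_mul_of_integrable (μ := MeasureTheory.volume)
      (f := fun _ : E => (1 : ℝ)) (g := fun y => ⟪v, F y⟫) (v := w)
      (by simp) (by simpa [hderiv] using hi)
      (by simpa using hi0)
      (fun x _ => differentiableAt_const _)
      (fun x _ => ((innerSL ℝ v).differentiableAt.comp x (hd x)))
    simpa [hderiv] using this
  have hdvg : ∀ y, dvg F y = ∑ i, ⟪b i, fderiv ℝ F y (b i)⟫ := fun y =>
    LinearMap.trace_eq_sum_inner _ b
  simp_rw [hdvg]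
  rw [MeasureTheory.integral_finsetSum _ fun i _ => (key _ _).1]
  exact Finset.sum_eq_zero fun i _ => (key _ _).2

theorem dvg_smul [FiniteDimensional ℝ E] {a : E → ℝ} {F : E → E} {y : E}
    (ha : DifferentiableAt ℝ a y) (hF : DifferentiableAt ℝ F y) :
    dvg (fun y => a y • F y) y = fderiv ℝ a y (F y) + a y * dvg F y := by
  unfold dvg
  have : (fderiv ℝ (fun y => a y • F y) y : E →ₗ[ℝ] E) =
      a y • (fderiv ℝ F y : E →ₗ[ℝ] E) +
        LinearMap.smulRight (fderiv ℝ a y : E →ₗ[ℝ] ℝ) (F y) := by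
    rw [(ha.hasFDerivAt.fun_smul hF.hasFDerivAt).fderiv]
    rfl
  rw [this, map_add, map_smul, LinearMap.trace_smulRight, smul_eq_mul, add_comm]
  rfl

theorem dvg_sub {F G : E → E} {y : E} (hF : DifferentiableAt ℝ F y)
    (hG : DifferentiableAt ℝ G y) : dvg (fun y => F y - G y) y = dvg F y - dvg G y := by
  unfold dvg
  have : (fderiv ℝ (fun y => F y - G y) y : E →ₗ[ℝ] E) =
      (fderiv ℝ F y : E →ₗ[ℝ] E) - (fderiv ℝ G y : E →ₗ[ℝ] E) := by
    rw [(hF.hasFDerivAt.fun_sub hG.hasFDerivAt).fderiv]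
    rfl
  rw [this, map_sub]

theorem dvg_sum {ι : Type*} {s : Finset ι} {F : ι → E → E} {y : E}
    (hF : ∀ i ∈ s, DifferentiableAt ℝ (F i) y) :
    dvg (fun y => ∑ i ∈ s, F i y) y = ∑ i ∈ s, dvg (F i) y := by
  unfold dvg
  have : (fderiv ℝ (fun y => ∑ i ∈ s, F i y) y : E →ₗ[ℝ] E) =
      ∑ i ∈ s, (fderiv ℝ (F i) y : E →ₗ[ℝ] E) := by
    rw [(HasFDerivAt.fun_sum fun i hi => (hF i hi).hasFDerivAt).fderiv]
    simp
  rw [this, map_sum]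

theorem dvg_const_smul [FiniteDimensional ℝ E] {F : E → E} {y : E} (c : ℝ)
    (hF : DifferentiableAt ℝ F y) :
    dvg (fun y => c • F y) y = c * dvg F y := by
  rw [dvg_smul (a := fun _ => c) (differentiableAt_const _) hF]
  simp

/-- The divergence of the identity vector field is the dimension. -/
theorem dvg_id [FiniteDimensional ℝ E] (y : E) : dvg (fun y : E => y) y = Module.finrank ℝ E := by
  unfold dvg
  rw [fderiv_fun_id]
  exact LinearMap.trace_id ℝ E

theorem dvg_smul_arg_of_homogeneous {Z : E → E} {c r : ℝ} (hc : c ≠ 0)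
    (h : ∀ y, Z (c • y) = r • Z y) (y : E) : dvg Z (c • y) = r / c * dvg Z y := by
  unfold dvg
  rw [fderiv_smul_of_homogeneous hc h]
  simp

/-- A vector field on punctured Euclidean space of dimension `n + 1` that is homogeneous of degree
`-n` and has nonnegative divergence on the unit sphere is divergence free there. -/
theorem dvg_eq_zero_of_nonneg [FiniteDimensional ℝ E] {n : ℕ} (hn : Module.finrank ℝ E = n + 1)
    {Z : E → E}
    (hZ : ContDiffOn ℝ 1 Z {y | y ≠ 0})
    (hom : ∀ (c : ℝ) (y : E), 0 < c → Z (c • y) = (c ^ n)⁻¹ • Z y)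
    (hnn : ∀ y, ‖y‖ = 1 → 0 ≤ dvg Z y) {x : E} (hx : ‖x‖ = 1) : dvg Z x = 0 := by
  let _ : MeasurableSpace E := borel E
  have _ : BorelSpace E := ⟨rfl⟩
  have hopen : IsOpen {y : E | y ≠ 0} := isOpen_ne
  have hnn' : ∀ y, y ≠ 0 → 0 ≤ dvg Z y := by
    intro y hy
    have hy' : 0 < ‖y‖ := norm_pos_iff.mpr hy
    have := dvg_smul_arg_of_homogeneous (c := ‖y‖) hy'.ne' (fun y' => hom ‖y‖ y' hy') (‖y‖⁻¹ • y)
    rw [smul_inv_smul₀ hy'.ne'] at this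
    rw [this]
    refine mul_nonneg (by positivity) (hnn _ ?_)
    rw [norm_smul, norm_inv, norm_norm, inv_mul_cancel₀ hy'.ne']
  let G : E → ℝ := fun y => ⟪y, Z y⟫ / ‖y‖ ^ 2
  let W : E → E := fun y => Z y - G y • y
  have hZat : ∀ y : E, y ≠ 0 → ContDiffAt ℝ 1 Z y := fun y hy =>
    hZ.contDiffAt (hopen.mem_nhds hy)
  have hGat : ∀ y : E, y ≠ 0 → ContDiffAt ℝ 1 G y := fun y hy =>
    (contDiffAt_id.inner ℝ (hZat y hy)).div ((contDiff_norm_sq ℝ).contDiffAt) (by positivity)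
  have hWat : ∀ y : E, y ≠ 0 → ContDiffAt ℝ 1 W y := fun y hy =>
    (hZat y hy).sub ((hGat y hy).smul contDiffAt_id)
  have hGhom : ∀ (c : ℝ) (y : E), 0 < c → G (c • y) = (c ^ (n + 1))⁻¹ • G y := by
    intro c y hc
    simp only [G, hom c y hc, inner_smul_left, inner_smul_right, norm_smul, smul_eq_mul,
      Real.norm_eq_abs, mul_pow, sq_abs, conj_trivial]
    field_simp
    ring
  have hdvgW : ∀ y : E, y ≠ 0 → dvg W y = dvg Z y := by
    intro y hy
    have hGd := (hGat y hy).differentiableAt one_ne_zero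
    have h1 : fderiv ℝ G y y = (-((n : ℝ) + 1)) • G y := by
      refine fderiv_apply_self_of_homogeneous (r := fun c => (c ^ (n + 1))⁻¹) hGd ?_
        (fun c hc => hGhom c y hc)
      have := (hasDerivAt_pow (n + 1) (1 : ℝ)).inv (by simp)
      convert! this using 1
      simp
    rw [dvg_sub (G := fun y => G y • y) ((hZat y hy).differentiableAt one_ne_zero)
        (hGd.fun_smul differentiableAt_id),
      dvg_smul (F := fun y => y) hGd differentiableAt_id, h1, dvg_id, hn]
    simp; ring
  let χ₀ : ContDiffBump (1 : ℝ) := ⟨1 / 4, 1 / 2, by norm_num, by norm_num⟩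
  let χ : E → ℝ := fun y => χ₀ (‖y‖ ^ 2)
  have hχ : ContDiff ℝ 1 χ := χ₀.contDiff.comp (contDiff_norm_sq ℝ)
  have hχ0 : ∀ y : E, ‖y‖ ^ 2 < 1 / 4 → χ y = 0 := by
    intro y hy
    refine χ₀.zero_of_le_dist ?_
    rw [Real.dist_eq, abs_sub_comm]
    refine le_trans ?_ (le_abs_self _)
    change (1 / 2 : ℝ) ≤ _
    linarith
  let F : E → E := fun y => χ y • W y
  have hF : ContDiff ℝ 1 F := by
    rw [contDiff_iff_contDiffAt]
    intro y
    by_cases hy : y = 0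
    · subst hy
      refine (contDiffAt_const (c := (0 : E))).congr_of_eventuallyEq ?_
      have : {y : E | ‖y‖ ^ 2 < 1 / 4} ∈ nhds (0 : E) :=
        (isOpen_lt (by fun_prop) (by fun_prop)).mem_nhds (by simp)
      filter_upwards [this] with y hy
      simp [F, hχ0 y hy]
    · exact hχ.contDiffAt.smul (hWat y hy)
  have hχc : HasCompactSupport χ := by
    refine HasCompactSupport.of_support_subset_isCompact (isCompact_closedBall (0 : E) 2) ?_
    intro y hy
    rw [mem_closedBall_zero_iff]
    by_contra! h
    refine hy (χ₀.zero_of_le_dist ?_)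
    rw [Real.dist_eq]
    refine le_trans ?_ (le_abs_self _)
    change (1 / 2 : ℝ) ≤ _
    nlinarith
  have hFc : HasCompactSupport F := hχc.smul_right
  have hdF : ∀ y : E, dvg F y = χ y * dvg Z y := by
    intro y
    by_cases hy : y = 0
    · subst hy
      have h0 : F =ᶠ[nhds 0] fun _ => 0 := by
        have : {y : E | ‖y‖ ^ 2 < 1 / 4} ∈ nhds (0 : E) :=
          (isOpen_lt (by fun_prop) (by fun_prop)).mem_nhds (by simp)
        filter_upwards [this] with y hy
        simp [F, hχ0 y hy]
      rw [dvg, h0.fderiv_eq, hχ0 0 (by simp)]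
      simp
    · rw [dvg_smul (hχ.differentiable one_ne_zero y) ((hWat y hy).differentiableAt one_ne_zero),
        hdvgW y hy]
      have hyW : ⟪y, W y⟫ = 0 := by
        simp only [W, G, inner_sub_right, inner_smul_right, real_inner_self_eq_norm_sq]
        have : ‖y‖ ≠ 0 := norm_ne_zero_iff.mpr hy
        field_simp
        ring
      have : fderiv ℝ χ y (W y) = 0 := by
        have h1 : HasFDerivAt (fun y : E => ‖y‖ ^ 2) (2 • innerSL ℝ y) y :=
          (hasStrictFDerivAt_norm_sq y).hasFDerivAt
        have h2 := (χ₀.contDiff (n := 1).differentiable one_ne_zero (‖y‖ ^ 2)).hasFDerivAt.comp y h1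
        change fderiv ℝ (χ₀ ∘ fun y : E => ‖y‖ ^ 2) y (W y) = 0
        rw [h2.fderiv]
        simp [hyW]
      rw [this, zero_add]
  have hint := integral_dvg_eq_zero hF hFc
  have hcont : Continuous (dvg F) := by
    have h1 : Continuous (fderiv ℝ F) := hF.continuous_fderiv one_ne_zero
    have h2 : dvg F = fun y => ∑ i, ⟪stdOrthonormalBasis ℝ E i,
        fderiv ℝ F y (stdOrthonormalBasis ℝ E i)⟫ :=
      funext fun y => LinearMap.trace_eq_sum_inner _ _
    rw [h2]
    fun_prop
  have hcs : HasCompactSupport (dvg F) :=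
    (hFc.fderiv ℝ).comp_left (g := fun L : E →L[ℝ] E => LinearMap.trace ℝ E (L : E →ₗ[ℝ] E))
      (by simp)
  have hFnn : 0 ≤ dvg F := by
    intro y
    by_cases hy : y = 0
    · simp [hdF, hy, hχ0 0]
    · rw [hdF]
      exact mul_nonneg χ₀.nonneg (hnn' y hy)
  have hχx : χ x = 1 := by
    simp only [χ, hx]
    refine χ₀.one_of_mem_closedBall ?_
    simp [χ₀]
  by_contra hne
  have hpos := hcont.integral_pos_of_hasCompactSupport_nonneg_nonzero
    (μ := MeasureTheory.volume) (x := x) hcs hFnn (by rw [hdF, hχx, one_mul]; exact hne)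
  exact hpos.ne' hint

end Divergence

section NewtonField

variable {E : Type*} [NormedAddCommGroup E] [InnerProductSpace ℝ E] [FiniteDimensional ℝ E]

theorem contDiff_linearMap_det {m : ℕ∞} :
    ContDiff ℝ m (fun L : E →L[ℝ] E => LinearMap.det (L : E →ₗ[ℝ] E)) := by
  let b := stdOrthonormalBasis ℝ E
  have h : ∀ L : E →L[ℝ] E, LinearMap.det (L : E →ₗ[ℝ] E) =
      ∑ σ : Equiv.Perm (Fin (Module.finrank ℝ E)),
        (Equiv.Perm.sign σ : ℝ) * ∏ i, ⟪b (σ i), L (b i)⟫ := by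
    intro L
    rw [← LinearMap.det_toMatrix b.toBasis, Matrix.det_apply']
    simp [LinearMap.toMatrix_apply, OrthonormalBasis.repr_apply_apply]
  simp_rw [h]
  refine ContDiff.sum fun σ _ => contDiff_const.mul (contDiff_prod fun i _ => ?_)
  exact contDiff_const.inner ℝ
    (((ContinuousLinearMap.apply ℝ E (b i)).contDiff).comp contDiff_id)

/-- Jacobi's formula for the derivative of the determinant at an invertible operator. -/
theorem fderiv_linearMap_det {M : E →L[ℝ] E} (hM : IsUnit M) (X : E →L[ℝ] E) :
    fderiv ℝ (fun L : E →L[ℝ] E => LinearMap.det (L : E →ₗ[ℝ] E)) M X =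
      LinearMap.det (M : E →ₗ[ℝ] E) *
        LinearMap.trace ℝ E ((Ring.inverse M * X : E →L[ℝ] E) : E →ₗ[ℝ] E) := by
  set D := fun L : E →L[ℝ] E => LinearMap.det (L : E →ₗ[ℝ] E) with hD
  have hd : HasFDerivAt D (fderiv ℝ D M) M :=
    ((contDiff_linearMap_det (m := 1)).differentiable one_ne_zero M).hasFDerivAt
  have h1 : HasDerivAt (fun h : ℝ => D (M + h • X)) (fderiv ℝ D M X) 0 := by
    have h2 : HasDerivAt (fun h : ℝ => M + h • X) X 0 := by
      simpa using ((hasDerivAt_id (0 : ℝ)).smul_const X).const_add M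
    refine HasFDerivAt.comp_hasDerivAt (0 : ℝ) (l := D) (f := fun h : ℝ => M + h • X) ?_ h2
    simpa using hd
  let b := stdOrthonormalBasis ℝ E
  set Y : Matrix _ _ ℝ := LinearMap.toMatrix b.toBasis b.toBasis
    ((Ring.inverse M * X : E →L[ℝ] E) : E →ₗ[ℝ] E) with hY
  have h3 : (fun h : ℝ => D (M + h • X)) = fun h => D M * Matrix.det (1 + h • Y) := by
    funext h
    have hfac : M + h • X = M * (1 + h • (Ring.inverse M * X)) := by
      rw [mul_add, mul_one, mul_smul_comm, ← mul_assoc, Ring.mul_inverse_cancel M hM, one_mul]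
    have hdet : Matrix.det (1 + h • Y) =
        LinearMap.det ((1 + h • (Ring.inverse M * X) : E →L[ℝ] E) : E →ₗ[ℝ] E) := by
      rw [← LinearMap.det_toMatrix b.toBasis]
      congr 1
      rw [hY, ← map_smul, ← LinearMap.toMatrix_one b.toBasis, ← map_add]
      rfl
    rw [hdet, hfac, hD]
    exact map_mul LinearMap.det (M : E →ₗ[ℝ] E) _
  have h4 : HasDerivAt (fun h : ℝ => Matrix.det (1 + h • Y)) Y.trace 0 := by
    let p := (Matrix.det (1 + (Polynomial.X : Polynomial ℝ) • Y.map Polynomial.C)).divX.divX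
    have hp : (fun h : ℝ => Matrix.det (1 + h • Y)) =
        fun h => 1 + Y.trace * h + p.eval h * h ^ 2 :=
      funext fun h => Matrix.det_one_add_smul h Y
    rw [hp]
    have h5 := ((hasDerivAt_id (0 : ℝ)).const_mul Y.trace).const_add 1 |>.add
      ((p.hasDerivAt 0).mul (hasDerivAt_pow 2 (0 : ℝ)))
    convert! h5 using 1
    simp
  have h6 := h4.const_mul (D M)
  rw [← h3] at h6
  rw [h1.unique h6, hY, ← LinearMap.trace_eq_matrix_trace]

/-- The opposite of the radial eigenvalue of the ambient form of the shifted tensor. -/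
def shiftCoeff (Φ : E → ℝ) (s : ℝ) (y : E) : ℝ := (s - ‖gradient Φ y‖ ^ 2) / (2 * Φ y)

/-- The Hessian of `Φ`, shifted by `shiftCoeff`. -/
def shiftedHess (Φ : E → ℝ) (s : ℝ) (y : E) : E →L[ℝ] E :=
  fderiv ℝ (gradient Φ) y + shiftCoeff Φ s y • (1 : E →L[ℝ] E)

/-- The vector field obtained by applying the normalized cofactor operator of `shiftedHess` to
the gradient. -/
def cofactorField (Φ : E → ℝ) (s : ℝ) (y : E) : E :=
  (LinearMap.det (shiftedHess Φ s y : E →ₗ[ℝ] E) * (shiftCoeff Φ s y * Φ y)⁻¹) •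
    Ring.inverse (shiftedHess Φ s y) (gradient Φ y)

theorem ContDiffAt.gradient' {Φ : E → ℝ} {y : E} {m k : ℕ∞} (h : ContDiffAt ℝ k Φ y)
    (hm : m + 1 ≤ k) : ContDiffAt ℝ m (gradient Φ) y :=
  (InnerProductSpace.toDual ℝ E).symm.toContinuousLinearEquiv.contDiff.contDiffAt.comp y
    (h.fderiv_right (by exact_mod_cast hm))

theorem ContDiffAt.shiftCoeff {Φ : E → ℝ} {y : E} (s : ℝ) (h : ContDiffAt ℝ (⊤ : ℕ∞) Φ y)
    (h0 : Φ y ≠ 0) : ContDiffAt ℝ (⊤ : ℕ∞) (shiftCoeff Φ s) y :=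
  (contDiffAt_const.sub ((h.gradient' (m := ⊤) (by simp)).norm_sq ℝ)).div
    (contDiffAt_const.mul h) (by simpa using h0)

theorem ContDiffAt.shiftedHess {Φ : E → ℝ} {y : E} (s : ℝ) (h : ContDiffAt ℝ (⊤ : ℕ∞) Φ y)
    (h0 : Φ y ≠ 0) : ContDiffAt ℝ (⊤ : ℕ∞) (shiftedHess Φ s) y :=
  ((h.gradient' (m := ⊤) (by simp)).fderiv_right (m := (⊤ : ℕ∞)) (by simp)).add
    ((h.shiftCoeff s h0).smul contDiffAt_const)

theorem ContDiffAt.ringInverse_shiftedHess {Φ : E → ℝ} {y : E} {s : ℝ}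
    (h : ContDiffAt ℝ (⊤ : ℕ∞) Φ y) (h0 : Φ y ≠ 0) (hM : IsUnit (_root_.shiftedHess Φ s y)) :
    ContDiffAt ℝ (⊤ : ℕ∞) (fun y => Ring.inverse (_root_.shiftedHess Φ s y)) y := by
  obtain ⟨u, hu⟩ := hM
  have hi : ContDiffAt ℝ (⊤ : ℕ∞) Ring.inverse (_root_.shiftedHess Φ s y) :=
    hu ▸ contDiffAt_ringInverse ℝ u
  exact hi.comp y (h.shiftedHess s h0)

theorem ContDiffAt.cofactorField {Φ : E → ℝ} {y : E} {s : ℝ}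
    (h : ContDiffAt ℝ (⊤ : ℕ∞) Φ y) (h0 : Φ y ≠ 0) (hν : _root_.shiftCoeff Φ s y ≠ 0)
    (hM : IsUnit (_root_.shiftedHess Φ s y)) :
    ContDiffAt ℝ (⊤ : ℕ∞) (cofactorField Φ s) y :=
  ((contDiff_linearMap_det.contDiffAt.comp y (h.shiftedHess s h0)).mul
    (((h.shiftCoeff s h0).mul h).inv (mul_ne_zero hν h0))).smul
      ((h.ringInverse_shiftedHess h0 hM).clm_apply (h.gradient' (by simp)))

/-- The divergence of `cofactorField`: all derivatives of third order cancel. -/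
theorem dvg_cofactorField {Φ : E → ℝ} {y : E} {s : ℝ}
    (h : ContDiffAt ℝ (⊤ : ℕ∞) Φ y) (h0 : Φ y ≠ 0) (hν : shiftCoeff Φ s y ≠ 0)
    (hM : IsUnit (shiftedHess Φ s y)) :
    dvg (cofactorField Φ s) y =
      LinearMap.det (shiftedHess Φ s y : E →ₗ[ℝ] E) * (shiftCoeff Φ s y * Φ y)⁻¹ *
        (LinearMap.trace ℝ E
            ((Ring.inverse (shiftedHess Φ s y) * fderiv ℝ (gradient Φ) y : E →L[ℝ] E) :
              E →ₗ[ℝ] E) -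
          ‖gradient Φ y‖ ^ 2 / Φ y *
            (LinearMap.trace ℝ E ((Ring.inverse (shiftedHess Φ s y) : E →L[ℝ] E) : E →ₗ[ℝ] E) -
              (shiftCoeff Φ s y)⁻¹)) := by
  have htop : ((⊤ : ℕ∞) : WithTop ℕ∞) ≠ 0 := by simp
  have hgC : ContDiffAt ℝ (⊤ : ℕ∞) (gradient Φ) y := h.gradient' (by simp)
  have hHC : ContDiffAt ℝ (⊤ : ℕ∞) (fderiv ℝ (gradient Φ)) y := hgC.fderiv_right (by simp)
  have hνC := h.shiftCoeff s h0
  have hMC := h.shiftedHess s h0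
  have hIC := h.ringInverse_shiftedHess h0 hM
  set g := gradient Φ with hg
  set ν := shiftCoeff Φ s with hνdef
  set M := shiftedHess Φ s with hMdef
  set N : E →L[ℝ] E := Ring.inverse (M y) with hN
  set H := fderiv ℝ g y with hH
  set z := N (g y) with hz
  have hMN : M y * N = 1 := Ring.mul_inverse_cancel _ hM
  have hMz : M y z = g y := by
    have := congrArg (fun L : E →L[ℝ] E => L (g y)) hMN
    simpa using this
  have hMNz : M y (N z) = z := by
    have := congrArg (fun L : E →L[ℝ] E => L z) hMN
    simpa using this
  have hΦ' : ∀ u, fderiv ℝ Φ y u = ⟪g y, u⟫ := by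
    intro u
    rw [hg, gradient, InnerProductSpace.toDual_symm_apply]
  have hν' : ∀ u, fderiv ℝ ν y u = -⟪g y, M y u⟫ / Φ y := by
    intro u
    have h1 := (hgC.differentiableAt htop).hasFDerivAt.norm_sq
    have h2 : HasFDerivAt (fun y => (s - ‖g y‖ ^ 2) * (2 * Φ y)⁻¹) _ y :=
      (h1.const_sub s).fun_mul ((hasDerivAt_inv (by simpa using h0)).comp_hasFDerivAt y
        ((h.differentiableAt htop).hasFDerivAt.const_mul 2))
    change fderiv ℝ (fun y => (s - ‖g y‖ ^ 2) * (2 * Φ y)⁻¹) y u = _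
    rw [h2.fderiv]
    have h3 : M y u = H u + ((s - ‖g y‖ ^ 2) / (2 * Φ y)) • u := rfl
    rw [h3, inner_add_right, inner_smul_right]
    simp [hΦ']
    field_simp
    ring
  have hM' : ∀ u, fderiv ℝ M y u = fderiv ℝ (fderiv ℝ g) y u + fderiv ℝ ν y u • 1 := by
    intro u
    have h2 : HasFDerivAt M _ y := (hHC.differentiableAt htop).hasFDerivAt.add
      ((hνC.differentiableAt htop).hasFDerivAt.smul_const (1 : E →L[ℝ] E))
    rw [h2.fderiv]
    rfl
  have hsymm : ∀ u v, fderiv ℝ (fderiv ℝ g) y u v = fderiv ℝ (fderiv ℝ g) y v u :=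
    fun u v => hgC.isSymmSndFDerivAt (by
      rw [minSmoothness_of_isRCLikeNormedField]
      exact WithTop.coe_le_coe.mpr (le_top : (2 : ℕ∞) ≤ ⊤)) u v
  have hN' : ∀ u, fderiv ℝ (fun y => Ring.inverse (M y)) y u = -(N * fderiv ℝ M y u * N) := by
    intro u
    obtain ⟨U, hU⟩ := hM
    have h1 : HasFDerivAt Ring.inverse _ (M y) := hU ▸ hasFDerivAt_ringInverse (𝕜 := ℝ) U
    have h2 := (h1.comp y (hMC.differentiableAt htop).hasFDerivAt).fderiv
    have h3 : (↑U⁻¹ : E →L[ℝ] E) = N := by rw [hN, ← hU, Ring.inverse_unit]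
    change fderiv ℝ (Ring.inverse ∘ M) y u = _
    rw [h2]
    simp [h3]
  have hw : ∀ u, fderiv ℝ (fun y => Ring.inverse (M y) (g y)) y u =
      N (H u) - N (fderiv ℝ (fderiv ℝ g) y z u) - fderiv ℝ ν y u • N z := by
    intro u
    rw [((hIC.differentiableAt htop).hasFDerivAt.clm_apply
      (hgC.differentiableAt htop).hasFDerivAt).fderiv]
    simp [hN', hM', ← hz, hsymm u z]
    abel
  have hdw : dvg (fun y => Ring.inverse (M y) (g y)) y =
      LinearMap.trace ℝ E ((N * H : E →L[ℝ] E) : E →ₗ[ℝ] E) -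
        LinearMap.trace ℝ E ((N * fderiv ℝ (fderiv ℝ g) y z : E →L[ℝ] E) : E →ₗ[ℝ] E) -
          fderiv ℝ ν y (N z) := by
    have : (fderiv ℝ (fun y => Ring.inverse (M y) (g y)) y : E →ₗ[ℝ] E) =
        ((N * H : E →L[ℝ] E) : E →ₗ[ℝ] E) -
          ((N * fderiv ℝ (fderiv ℝ g) y z : E →L[ℝ] E) : E →ₗ[ℝ] E) -
          LinearMap.smulRight (fderiv ℝ ν y : E →ₗ[ℝ] ℝ) (N z) := by
      ext u
      exact hw u
    rw [dvg, this, map_sub, map_sub, LinearMap.trace_smulRight]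
    rfl
  have hdet : HasFDerivAt (fun y => LinearMap.det (M y : E →ₗ[ℝ] E)) _ y :=
    HasFDerivAt.comp y (g := fun L : E →L[ℝ] E => LinearMap.det (L : E →ₗ[ℝ] E))
      ((contDiff_linearMap_det (m := 1)).differentiable one_ne_zero (M y)).hasFDerivAt
      (hMC.differentiableAt htop).hasFDerivAt
  have hνΦ : HasFDerivAt (fun y => ν y * Φ y) _ y :=
    (hνC.differentiableAt htop).hasFDerivAt.fun_mul (h.differentiableAt htop).hasFDerivAt
  have hinv : HasFDerivAt (fun y => (ν y * Φ y)⁻¹) _ y :=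
    (hasDerivAt_inv (mul_ne_zero hν h0)).comp_hasFDerivAt y hνΦ
  have ha : HasFDerivAt (fun y => LinearMap.det (M y : E →ₗ[ℝ] E) * (ν y * Φ y)⁻¹) _ y :=
    hdet.fun_mul hinv
  have hsplit : LinearMap.trace ℝ E ((N * fderiv ℝ M y z : E →L[ℝ] E) : E →ₗ[ℝ] E) =
      LinearMap.trace ℝ E ((N * fderiv ℝ (fderiv ℝ g) y z : E →L[ℝ] E) : E →ₗ[ℝ] E) +
        fderiv ℝ ν y z * LinearMap.trace ℝ E (N : E →ₗ[ℝ] E) := by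
    rw [hM', mul_add, mul_smul_comm, mul_one]
    simp
  have hZ : cofactorField Φ s = fun y => (LinearMap.det (M y : E →ₗ[ℝ] E) * (ν y * Φ y)⁻¹) •
    (fun y => Ring.inverse (M y) (g y)) y := rfl
  rw [hZ, dvg_smul ha.differentiableAt
    ((hIC.differentiableAt htop).clm_apply (hgC.differentiableAt htop)), hdw, ha.fderiv]
  simp only [add_apply, smul_apply,
    ContinuousLinearMap.comp_apply, smul_eq_mul, fderiv_linearMap_det hM, ← hN, ← hz, hsplit, hν',
    hΦ', hMz, hMNz, real_inner_self_eq_norm_sq]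
  field_simp
  ring

end NewtonField

section Symmetric

variable {ι : Type*} [Fintype ι] [DecidableEq ι]

/-- The `k`-th elementary symmetric function of the entries of `l` other than the `i`-th one. -/
def punctEsymm (l : ι → ℝ) (k : ℕ) (i : ι) : ℝ :=
  ∑ t ∈ powersetCard k (univ.erase i), ∏ j ∈ t, l j

theorem sum_punctEsymm (l : ι → ℝ) (k : ℕ) (hk : k ≤ Fintype.card ι) :
    ∑ i, punctEsymm l k i =
      ((Fintype.card ι : ℝ) - k) * ∑ t ∈ powersetCard k univ, ∏ j ∈ t, l j := by
  unfold punctEsymm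
  rw [Finset.sum_comm' (t' := powersetCard k univ) (s' := fun t => tᶜ), Finset.mul_sum]
  · refine Finset.sum_congr rfl fun t ht => ?_
    rw [Finset.sum_const, card_compl, (mem_powersetCard.mp ht).2, nsmul_eq_mul, Nat.cast_sub hk]
  · intro i t
    simp only [mem_powersetCard, mem_univ, true_and, mem_compl, subset_univ, subset_erase]

theorem punctEsymm_le_of_le {l : ι → ℝ} (hl : ∀ i, 0 ≤ l i) (k : ℕ) {i j : ι}
    (hij : l i ≤ l j) : punctEsymm l k j ≤ punctEsymm l k i := by
  unfold punctEsymm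
  have h : univ.erase j = (univ.erase i).map (Equiv.swap i j).toEmbedding := by
    simp [map_erase]
  rw [h, powersetCard_map, sum_map]
  refine Finset.sum_le_sum fun t ht => ?_
  simp only [RelEmbedding.coe_toEmbedding, mapEmbedding_apply, prod_map, Equiv.coe_toEmbedding]
  refine prod_le_prod (fun a _ => hl _) fun a ha => ?_
  have hai : a ≠ i := (mem_erase.mp ((mem_powersetCard.mp ht).1 ha)).1
  by_cases haj : a = j
  · rw [haj, Equiv.swap_apply_right]
    exact hij
  · rw [Equiv.swap_apply_of_ne_of_ne hai haj]

/-- Chebyshev's inequality for the derivatives of an elementary symmetric function. -/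
theorem sum_sub_mul_punctEsymm_le {l : ι → ℝ} (hl : ∀ i, 0 ≤ l i) {k : ℕ}
    (hk : k ≤ Fintype.card ι) [Nonempty ι] (u : ℝ) :
    ∑ i, (l i - u) * punctEsymm l k i ≤
      (((Fintype.card ι : ℝ) - k) / Fintype.card ι) *
        (∑ t ∈ powersetCard k univ, ∏ j ∈ t, l j) * (∑ i, l i - Fintype.card ι * u) := by
  have hanti : Antivary l (punctEsymm l k) := fun i j hij => by
    by_contra! h
    exact absurd (punctEsymm_le_of_le hl k h.le) (not_le.mpr hij)
  have h1 := hanti.card_mul_sum_le_sum_mul_sum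
  have h2 : (0 : ℝ) < Fintype.card ι := by exact_mod_cast Fintype.card_pos
  rw [sum_punctEsymm l k hk] at h1
  simp_rw [sub_mul]
  rw [Finset.sum_sub_distrib, ← Finset.mul_sum, sum_punctEsymm l k hk]
  rw [← mul_le_mul_iff_right₀ h2]
  refine (mul_sub _ _ _).trans_le ((sub_le_sub_right h1 _).trans_eq ?_)
  field_simp

/-- The coefficients of a polynomial are linear combinations of its values at nodes. -/
theorem coeff_eq_sum_eval {n : ℕ} {v : Fin n → ℝ} (hv : Function.Injective v)
    {p : Polynomial ℝ} (hp : p.degree < n) (m : ℕ) :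
    p.coeff m = ∑ j, (Lagrange.basis univ v j).coeff m * p.eval (v j) := by
  have h : p = Lagrange.interpolate univ v fun j => p.eval (v j) :=
    Lagrange.eq_interpolate hv.injOn (by simpa using hp)
  conv_lhs => rw [h, Lagrange.interpolate_apply]
  simp [Polynomial.finsetSum_coeff, mul_comm]

theorem sum_basis_coeff_mul_sum_prod {n k : ℕ} (hk : k + 1 ≤ n) {v : Fin n → ℝ}
    (hv : Function.Injective v) (l a : Fin n → ℝ) (r : ℝ) :
    ∑ j, (Lagrange.basis univ v j).coeff (n - 1 - k) *
        ∑ i, a i * ∏ m ∈ univ.erase i, (l m + v j * r) =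
      r ^ (n - 1 - k) * ∑ i, a i * punctEsymm l k i := by
  let q : Fin n → Polynomial ℝ := fun i =>
    (∏ m ∈ univ.erase i, (Polynomial.X + Polynomial.C (l m))).comp
      (Polynomial.C r * Polynomial.X)
  let p : Polynomial ℝ := ∑ i, Polynomial.C (a i) * q i
  have hcard : ∀ i : Fin n, #(univ.erase i) = n - 1 := fun i => by simp
  have hdeg : p.degree < n := by
    refine (Polynomial.degree_lt_iff_coeff_zero _ _).mpr fun m hm => ?_
    simp only [p, q, Polynomial.finsetSum_coeff, Polynomial.coeff_C_mul,
      Polynomial.comp_C_mul_X_coeff]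
    refine Finset.sum_eq_zero fun i _ => ?_
    rw [Polynomial.coeff_eq_zero_of_natDegree_lt, zero_mul, mul_zero]
    rw [Polynomial.natDegree_prod_of_monic _ _ fun j _ => Polynomial.monic_X_add_C _]
    simp only [Polynomial.natDegree_X_add_C, sum_const, hcard, smul_eq_mul]
    omega
  have heval : ∀ t, p.eval t = ∑ i, a i * ∏ m ∈ univ.erase i, (l m + t * r) := by
    intro t
    simp only [p, q, Polynomial.eval_finsetSum, Polynomial.eval_mul, Polynomial.eval_C,
      Polynomial.eval_comp, Polynomial.eval_prod, Polynomial.eval_add, Polynomial.eval_X]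
    simp_rw [fun m => add_comm (l m), mul_comm r]
  have hcoeff : p.coeff (n - 1 - k) = r ^ (n - 1 - k) * ∑ i, a i * punctEsymm l k i := by
    simp only [p, q, Polynomial.finsetSum_coeff, Polynomial.coeff_C_mul,
      Polynomial.comp_C_mul_X_coeff, Finset.mul_sum]
    refine Finset.sum_congr rfl fun i _ => ?_
    rw [Finset.prod_X_add_C_coeff _ _ (by rw [hcard]; omega), hcard,
      show n - 1 - (n - 1 - k) = k by omega, punctEsymm]
    ring
  rw [← hcoeff, coeff_eq_sum_eval hv hdeg]
  simp_rw [heval]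

theorem sigmaMat_diagonal {N : ℕ} (k : ℕ) (d : Fin N → ℝ) :
    sigmaMat k (Matrix.diagonal d) = ∑ t ∈ powersetCard k univ, ∏ j ∈ t, d j := by
  refine Finset.sum_congr rfl fun s _ => ?_
  have : (Matrix.of fun i j : {a : Fin N // a ∈ s} => Matrix.diagonal d i.1 j.1) =
      Matrix.diagonal fun i : {a : Fin N // a ∈ s} => d i := by
    ext i j
    simp only [Matrix.of_apply, Matrix.diagonal_apply, Subtype.ext_iff]
  rw [this, Matrix.det_diagonal, Finset.prod_coe_sort s d]

end Symmetric

section Diagonalization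

variable {E : Type*} [NormedAddCommGroup E] [InnerProductSpace ℝ E] {ι : Type*} [Fintype ι]

theorem det_eq_prod_of_orthonormalBasis [DecidableEq ι] {L : E →L[ℝ] E}
    {b : OrthonormalBasis ι ℝ E} {d : ι → ℝ}
    (h : ∀ i, L (b i) = d i • b i) : LinearMap.det (L : E →ₗ[ℝ] E) = ∏ i, d i := by
  rw [← LinearMap.det_toMatrix b.toBasis, ← Matrix.det_diagonal]
  congr 1
  ext i j
  rw [LinearMap.toMatrix_apply, b.coe_toBasis, Matrix.diagonal_apply]
  simp only [ContinuousLinearMap.coe_coe, h, OrthonormalBasis.coe_toBasis_repr_apply,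
    OrthonormalBasis.repr_apply_apply, inner_smul_right, b.inner_eq_ite]
  grind

theorem trace_eq_sum_of_orthonormalBasis {L : E →L[ℝ] E} {b : OrthonormalBasis ι ℝ E} {d : ι → ℝ}
    (h : ∀ i, L (b i) = d i • b i) : LinearMap.trace ℝ E (L : E →ₗ[ℝ] E) = ∑ i, d i := by
  rw [LinearMap.trace_eq_sum_inner _ b]
  refine Finset.sum_congr rfl fun i _ => ?_
  rw [ContinuousLinearMap.coe_coe, h, inner_smul_right, real_inner_self_eq_norm_sq,
    b.norm_eq_one]
  ring

theorem isUnit_of_orthonormalBasis [FiniteDimensional ℝ E] [DecidableEq ι] {L : E →L[ℝ] E}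
    {b : OrthonormalBasis ι ℝ E} {d : ι → ℝ}
    (h : ∀ i, L (b i) = d i • b i) (hd : ∀ i, d i ≠ 0) : IsUnit L := by
  have h1 : IsUnit (L : E →ₗ[ℝ] E) := by
    rw [LinearMap.isUnit_iff_isUnit_det, det_eq_prod_of_orthonormalBasis h]
    exact (Finset.prod_ne_zero_iff.mpr fun i _ => hd i).isUnit
  exact h1.map (Module.End.toContinuousLinearMap E)

theorem ringInverse_apply_of_orthonormalBasis [FiniteDimensional ℝ E] [DecidableEq ι]
    {L : E →L[ℝ] E} {b : OrthonormalBasis ι ℝ E} {d : ι → ℝ} (h : ∀ i, L (b i) = d i • b i)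
    (hd : ∀ i, d i ≠ 0) (i : ι) :
    Ring.inverse L (b i) = (d i)⁻¹ • b i := by
  have h1 := congrArg (fun T : E →L[ℝ] E => T (b i))
    (Ring.inverse_mul_cancel L (isUnit_of_orthonormalBasis h hd))
  simp only [mul_apply_eq_comp, one_apply_eq_self, h, map_smul] at h1
  rw [← h1, inv_smul_smul₀ (hd i), h1]

/-- A symmetric operator with a given unit vector in its kernel is diagonal in an orthonormal basis
starting with that vector. -/
theorem exists_orthonormalBasis_eigenvectors [FiniteDimensional ℝ E] {n : ℕ}
    (hn : Module.finrank ℝ E = n + 1)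
    {H : E →L[ℝ] E} (hH : ∀ v w, ⟪H v, w⟫ = ⟪v, H w⟫) {x : E} (hx : ‖x‖ = 1) (hHx : H x = 0) :
    ∃ (b : OrthonormalBasis (Fin (n + 1)) ℝ E) (h : Fin n → ℝ), b 0 = x ∧
      ∀ i : Fin n, H (b i.succ) = h i • b i.succ := by
  have _ : Fact (Module.finrank ℝ E = n + 1) := ⟨hn⟩
  have hx0 : x ≠ 0 := by rintro rfl; simp at hx
  let K := (ℝ ∙ x)ᗮ
  have hK : Module.finrank ℝ K = n := Submodule.finrank_orthogonal_span_singleton hx0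
  have hmaps : ∀ v ∈ K, (H : E →ₗ[ℝ] E) v ∈ K := by
    intro v _
    rw [Submodule.mem_orthogonal_singleton_iff_inner_right, ContinuousLinearMap.coe_coe, ← hH, hHx,
      inner_zero_left]
  have hS : (H : E →ₗ[ℝ] E).IsSymmetric := hH
  have hS' := hS.restrict_invariant hmaps
  let e := hS'.eigenvectorBasis hK
  let v : Fin (n + 1) → E := Fin.cons x fun i => (e i : E)
  have hxe : ∀ i, ⟪x, (e i : E)⟫ = 0 := fun i =>
    Submodule.mem_orthogonal_singleton_iff_inner_right.mp (e i).2
  have hv : Orthonormal ℝ v := by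
    rw [orthonormal_iff_ite]
    intro i j
    refine Fin.cases ?_ (fun i => ?_) i <;> refine Fin.cases ?_ (fun j => ?_) j
    · simp [v, hx]
    · simp [v, hxe, (Fin.succ_ne_zero j).symm]
    · simp [v, real_inner_comm, hxe]
    · simpa [v] using e.inner_eq_ite i j
  obtain ⟨b, hb⟩ := Orthonormal.exists_orthonormalBasis_extension_of_card_eq (𝕜 := ℝ) (v := v)
    (s := Set.univ) (by simp [hn]) (hv.comp _ Subtype.val_injective)
  refine ⟨b, hS'.eigenvalues hK, by simp [hb, v], fun i => ?_⟩
  have := congrArg Subtype.val (hS'.apply_eigenvectorBasis hK i)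
  rw [hb _ (Set.mem_univ _)]
  exact this

end Diagonalization

section Homogeneous

variable {E : Type*} [NormedAddCommGroup E] [InnerProductSpace ℝ E] [FiniteDimensional ℝ E]
  {Φ : E → ℝ}

theorem gradient_smul_of_homogeneous (hom : ∀ (c : ℝ) (y : E), 0 < c → Φ (c • y) = c * Φ y)
    {c : ℝ} (hc : 0 < c) (y : E) : gradient Φ (c • y) = gradient Φ y := by
  rw [gradient, fderiv_smul_of_homogeneous hc.ne' (fun y => hom c y hc), div_self hc.ne', one_smul,
    gradient]

theorem fderiv_gradient_smul_of_homogeneous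
    (hom : ∀ (c : ℝ) (y : E), 0 < c → Φ (c • y) = c * Φ y) {c : ℝ} (hc : 0 < c) (y : E) :
    fderiv ℝ (gradient Φ) (c • y) = c⁻¹ • fderiv ℝ (gradient Φ) y := by
  rw [fderiv_smul_of_homogeneous (r := 1) hc.ne'
    (fun y => by rw [gradient_smul_of_homogeneous hom hc, one_smul]), one_div]

theorem shiftCoeff_smul_of_homogeneous
    (hom : ∀ (c : ℝ) (y : E), 0 < c → Φ (c • y) = c * Φ y) (s : ℝ) {c : ℝ} (hc : 0 < c) (y : E) :
    shiftCoeff Φ s (c • y) = c⁻¹ * shiftCoeff Φ s y := by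
  rw [shiftCoeff, shiftCoeff, gradient_smul_of_homogeneous hom hc, hom c y hc]
  field_simp

theorem shiftedHess_smul_of_homogeneous
    (hom : ∀ (c : ℝ) (y : E), 0 < c → Φ (c • y) = c * Φ y) (s : ℝ) {c : ℝ} (hc : 0 < c) (y : E) :
    shiftedHess Φ s (c • y) = c⁻¹ • shiftedHess Φ s y := by
  rw [shiftedHess, shiftedHess, fderiv_gradient_smul_of_homogeneous hom hc,
    shiftCoeff_smul_of_homogeneous hom s hc, smul_add, mul_smul]

theorem isUnit_smul_of_ne_zero {A : Type*} [Ring A] [Algebra ℝ A] {c : ℝ} (hc : c ≠ 0) {a : A}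
    (ha : IsUnit a) : IsUnit (c • a) := by
  rw [Algebra.smul_def]
  exact (hc.isUnit.map (algebraMap ℝ A)).mul ha

theorem ringInverse_smul {A : Type*} [Ring A] [Algebra ℝ A] {c : ℝ} (hc : c ≠ 0) (a : A) :
    Ring.inverse (c • a) = c⁻¹ • Ring.inverse a := by
  by_cases ha : IsUnit a
  · refine (isUnit_smul_of_ne_zero hc ha).mul_left_cancel ?_
    rw [Ring.mul_inverse_cancel _ (isUnit_smul_of_ne_zero hc ha),
      smul_mul_smul_comm, mul_inv_cancel₀ hc, one_smul,
      Ring.mul_inverse_cancel _ ha]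
  · rw [Ring.inverse_non_unit _ ha, smul_zero, Ring.inverse_non_unit]
    intro h'
    have := isUnit_smul_of_ne_zero (inv_ne_zero hc) h'
    rw [inv_smul_smul₀ hc] at this
    exact ha this

theorem cofactorField_smul_of_homogeneous {n : ℕ} (hn : Module.finrank ℝ E = n + 1)
    (hom : ∀ (c : ℝ) (y : E), 0 < c → Φ (c • y) = c * Φ y) (s : ℝ) {c : ℝ} (hc : 0 < c) (y : E) :
    cofactorField Φ s (c • y) = (c ^ n)⁻¹ • cofactorField Φ s y := by
  simp only [cofactorField, shiftedHess_smul_of_homogeneous hom s hc,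
    shiftCoeff_smul_of_homogeneous hom s hc, gradient_smul_of_homogeneous hom hc, hom c y hc,
    ringInverse_smul (inv_ne_zero hc.ne'),
    ContinuousLinearMap.toLinearMap_smul, LinearMap.det_smul, hn]
  rw [smul_apply, smul_smul, smul_smul]
  congr 1
  rw [inv_pow, pow_succ]
  field_simp

theorem fderiv_gradient_apply_self (hom : ∀ (c : ℝ) (y : E), 0 < c → Φ (c • y) = c * Φ y)
    {y : E} (h : ContDiffAt ℝ (⊤ : ℕ∞) Φ y) : fderiv ℝ (gradient Φ) y y = 0 := by
  rw [fderiv_apply_self_of_homogeneous (r := fun _ => 1) (r' := 0)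
    ((h.gradient' (m := 1) le_top).differentiableAt one_ne_zero) (hasDerivAt_const _ _)
    (fun c hc => by rw [gradient_smul_of_homogeneous hom hc, one_smul]), zero_smul]

theorem inner_fderiv_gradient_comm {y : E} (h : ContDiffAt ℝ (⊤ : ℕ∞) Φ y) (v w : E) :
    ⟪fderiv ℝ (gradient Φ) y v, w⟫ = ⟪v, fderiv ℝ (gradient Φ) y w⟫ := by
  have h1 : ∀ v w, ⟪fderiv ℝ (gradient Φ) y v, w⟫ = fderiv ℝ (fderiv ℝ Φ) y v w := by
    intro v w
    have h2 : HasFDerivAt (gradient Φ) _ y :=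
      (InnerProductSpace.toDual ℝ E).symm.toContinuousLinearEquiv.hasFDerivAt.comp y
        ((h.fderiv_right (m := (⊤ : ℕ∞)) (by simp)).differentiableAt (by simp)).hasFDerivAt
    rw [h2.fderiv]
    exact InnerProductSpace.toDual_symm_apply
  rw [h1, real_inner_comm, h1]
  refine h.isSymmSndFDerivAt ?_ v w
  rw [minSmoothness_of_isRCLikeNormedField]
  exact WithTop.coe_le_coe.mpr (le_top : (2 : ℕ∞) ≤ ⊤)

/-- The divergence of `cofactorField` in a frame of eigenvectors. -/
theorem dvg_cofactorField_eq_sum {n : ℕ} {y : E} {s : ℝ} (h : ContDiffAt ℝ (⊤ : ℕ∞) Φ y)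
    (h0 : Φ y ≠ 0) (hν : shiftCoeff Φ s y ≠ 0) {b : OrthonormalBasis (Fin (n + 1)) ℝ E}
    {d : Fin n → ℝ} (hb0 : fderiv ℝ (gradient Φ) y (b 0) = 0)
    (hb : ∀ i : Fin n, fderiv ℝ (gradient Φ) y (b i.succ) = d i • b i.succ)
    (hd : ∀ i, d i + shiftCoeff Φ s y ≠ 0) :
    dvg (cofactorField Φ s) y = (Φ y)⁻¹ * ∑ i, (d i - ‖gradient Φ y‖ ^ 2 / Φ y) *
      ∏ j ∈ univ.erase i, (d j + shiftCoeff Φ s y) := by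
  set ν := shiftCoeff Φ s y with hνdef
  set H := fderiv ℝ (gradient Φ) y with hH
  have hHb : ∀ i, H (b i) = (Fin.cons 0 d : Fin (n + 1) → ℝ) i • b i := by
    refine Fin.cases ?_ fun i => ?_
    · simp [hb0]
    · simp [hb]
  let m : Fin (n + 1) → ℝ := Fin.cons ν fun i => d i + ν
  have hMb : ∀ i, shiftedHess Φ s y (b i) = m i • b i := by
    intro i
    have : shiftedHess Φ s y (b i) = H (b i) + ν • b i := rfl
    rw [this, hHb, ← add_smul]
    refine Fin.cases ?_ (fun i => ?_) i <;> simp [m]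
  have hm : ∀ i, m i ≠ 0 := Fin.cases hν hd
  have hNb := ringInverse_apply_of_orthonormalBasis hMb hm
  have hNHb : ∀ i, (Ring.inverse (shiftedHess Φ s y) * H) (b i) =
      ((Fin.cons 0 d : Fin (n + 1) → ℝ) i * (m i)⁻¹) • b i := by
    intro i
    rw [mul_apply_eq_comp, hHb, map_smul, hNb, smul_smul]
  rw [dvg_cofactorField h h0 hν (isUnit_of_orthonormalBasis hMb hm),
    det_eq_prod_of_orthonormalBasis hMb, trace_eq_sum_of_orthonormalBasis hNb,
    trace_eq_sum_of_orthonormalBasis hNHb]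
  simp only [m, Fin.sum_univ_succ, Fin.prod_univ_succ, Fin.cons_zero, Fin.cons_succ, ← hνdef]
  have hprod : ∀ i, ∏ j ∈ univ.erase i, (d j + ν) = (∏ j, (d j + ν)) * (d i + ν)⁻¹ := by
    intro i
    rw [← Finset.mul_prod_erase univ _ (mem_univ i)]
    field_simp [hd i]
  have : ∑ i, (d i - ‖gradient Φ y‖ ^ 2 / Φ y) * ∏ j ∈ univ.erase i, (d j + ν) =
      (∏ j, (d j + ν)) * (∑ i, d i * (d i + ν)⁻¹ -
        ‖gradient Φ y‖ ^ 2 / Φ y * ∑ i, (d i + ν)⁻¹) := by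
    rw [Finset.mul_sum, ← Finset.sum_sub_distrib, Finset.mul_sum]
    refine Finset.sum_congr rfl fun i _ => ?_
    rw [hprod]
    ring
  rw [this]
  field_simp
  ring

end Homogeneous

section Cone

variable {n : ℕ} {φ : Euc n → ℝ}

/-- The 1-homogeneous function agreeing with `φ` on the unit sphere. -/
def coneExt (φ : Euc n → ℝ) (y : Euc n) : ℝ := ‖y‖ * φ y

theorem coneExt_smul (hφ : Homog0 φ) (c : ℝ) (y : Euc n) (hc : 0 < c) :
    coneExt φ (c • y) = c * coneExt φ y := by
  rw [coneExt, coneExt, hφ c y hc, norm_smul, Real.norm_of_nonneg hc.le, mul_assoc]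

theorem Homog0.pos (hφ : Homog0 φ) (hpos : ∀ x ∈ uSphere n, 0 < φ x) {y : Euc n} (hy : y ≠ 0) :
    0 < φ y := by
  have hy' : 0 < ‖y‖ := norm_pos_iff.mpr hy
  rw [← hφ ‖y‖⁻¹ y (by positivity)]
  refine hpos _ ?_
  rw [uSphere, mem_sphere_zero_iff_norm, norm_smul, norm_inv, norm_norm, inv_mul_cancel₀ hy'.ne']

theorem SmoothFn.contDiffAt (hs : SmoothFn φ) {y : Euc n} (hy : y ≠ 0) :
    ContDiffAt ℝ (⊤ : ℕ∞) φ y :=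
  ContDiffOn.contDiffAt hs (isOpen_ne.mem_nhds hy)

theorem SmoothFn.differentiableAt (hs : SmoothFn φ) {y : Euc n} (hy : y ≠ 0) :
    DifferentiableAt ℝ φ y :=
  (hs.contDiffAt hy).differentiableAt (by simp)

theorem SmoothFn.contDiffAt_coneExt (hs : SmoothFn φ) {y : Euc n} (hy : y ≠ 0) :
    ContDiffAt ℝ (⊤ : ℕ∞) (coneExt φ) y :=
  (contDiffAt_norm ℝ hy).mul (hs.contDiffAt hy)

theorem inner_gradient_eq_fderiv (y v : Euc n) : ⟪gradient φ y, v⟫ = fderiv ℝ φ y v := by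
  rw [gradient, InnerProductSpace.toDual_symm_apply]

theorem Homog0.fderiv_apply_self (hφ : Homog0 φ) (hs : SmoothFn φ) {y : Euc n} (hy : y ≠ 0) :
    fderiv ℝ φ y y = 0 := by
  rw [fderiv_apply_self_of_homogeneous (r := fun _ => 1) (r' := 0) (hs.differentiableAt hy)
    (hasDerivAt_const _ _) (fun c hc => by rw [hφ c y hc, one_smul]), zero_smul]

theorem Homog0.inner_gradient_self (hφ : Homog0 φ) (hs : SmoothFn φ) {y : Euc n} (hy : y ≠ 0) :
    ⟪gradient φ y, y⟫ = 0 := by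
  rw [inner_gradient_eq_fderiv, hφ.fderiv_apply_self hs hy]

theorem hasFDerivAt_norm_of_ne_zero {E : Type*} [NormedAddCommGroup E] [InnerProductSpace ℝ E]
    {y : E} (hy : y ≠ 0) : HasFDerivAt (fun y : E => ‖y‖) (‖y‖⁻¹ • innerSL ℝ y) y := by
  have hy' : ‖y‖ ≠ 0 := norm_ne_zero_iff.mpr hy
  have h := (hasStrictFDerivAt_norm_sq y).hasFDerivAt.sqrt (pow_ne_zero 2 hy')
  simp only [Real.sqrt_sq (norm_nonneg _)] at h
  refine h.congr_fderiv ?_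
  ext v
  simp
  field_simp

theorem SmoothFn.gradient_coneExt (hs : SmoothFn φ) {y : Euc n} (hy : y ≠ 0) :
    gradient (coneExt φ) y = (φ y * ‖y‖⁻¹) • y + ‖y‖ • gradient φ y := by
  refine ext_inner_right ℝ fun v => ?_
  have h : HasFDerivAt (coneExt φ) _ y :=
    (hasFDerivAt_norm_of_ne_zero hy).fun_mul (hs.differentiableAt hy).hasFDerivAt
  rw [inner_gradient_eq_fderiv, h.fderiv, inner_add_left, inner_smul_left, inner_smul_left,
    inner_gradient_eq_fderiv]
  simp
  ring

theorem norm_gradient_coneExt_sq (hφ : Homog0 φ) (hs : SmoothFn φ) {y : Euc n} (hy : y ≠ 0) :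
    ‖gradient (coneExt φ) y‖ ^ 2 = φ y ^ 2 + ‖y‖ ^ 2 * ‖gradient φ y‖ ^ 2 := by
  have hy' : ‖y‖ ≠ 0 := norm_ne_zero_iff.mpr hy
  rw [hs.gradient_coneExt hy, norm_add_sq_real, inner_smul_left, inner_smul_right, real_inner_comm,
    hφ.inner_gradient_self hs hy, norm_smul, norm_smul]
  simp only [mul_pow, Real.norm_eq_abs, sq_abs]
  field_simp
  simp

theorem inner_gradient_gradient_coneExt (hφ : Homog0 φ) (hs : SmoothFn φ) {y : Euc n}
    (hy : y ≠ 0) : ⟪gradient φ y, gradient (coneExt φ) y⟫ = ‖y‖ * ‖gradient φ y‖ ^ 2 := by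
  rw [hs.gradient_coneExt hy, inner_add_right, inner_smul_right, inner_smul_right,
    hφ.inner_gradient_self hs hy, real_inner_self_eq_norm_sq]
  ring

theorem covD_eq_fderiv (hφ : Homog0 φ) (hs : SmoothFn φ) {y : Euc n} (hy : y ≠ 0) (v : Euc n) :
    covD φ y v = fderiv ℝ φ y v := by
  rw [covD, tanProj, map_sub, map_smul, hφ.fderiv_apply_self hs hy, smul_zero, sub_zero]

theorem tanProj_of_inner_eq_zero {x v : Euc n} (h : ⟪x, v⟫ = 0) : tanProj x v = v := by
  rw [tanProj, h, zero_div, zero_smul, sub_zero]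

theorem ne_zero_of_mem_uSphere {x : Euc n} (hx : x ∈ uSphere n) : x ≠ 0 :=
  ne_zero_of_mem_unit_sphere (⟨x, hx⟩ : Metric.sphere (0 : Euc n) 1)

theorem norm_of_mem_uSphere {x : Euc n} (hx : x ∈ uSphere n) : ‖x‖ = 1 :=
  mem_sphere_zero_iff_norm.mp hx

/-- The tensor `A[φ]` in terms of the Hessian of the 1-homogeneous extension of `φ`. -/
theorem Aform_eq_inner (hφ : Homog0 φ) (hs : SmoothFn φ) {x : Euc n}
    (hx : x ∈ uSphere n) {v w : Euc n} (hv : ⟪x, v⟫ = 0) (hw : ⟪x, w⟫ = 0) (h0 : φ x ≠ 0) :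
    Aform φ x v w = ⟪fderiv ℝ (gradient (coneExt φ)) x v, w⟫ -
      (‖gradient (coneExt φ) x‖ ^ 2 + 1) / (2 * coneExt φ x) * ⟪v, w⟫ := by
  have hx0 := ne_zero_of_mem_uSphere hx
  have hx1 := norm_of_mem_uSphere hx
  have hev : ∀ᶠ y in nhds x, y ≠ 0 := isOpen_ne.mem_nhds hx0
  have hg : HasFDerivAt (gradient φ) (fderiv ℝ (gradient φ) x) x :=
    (((hs.contDiffAt hx0).gradient' (m := ⊤) (by simp)).differentiableAt (by simp)).hasFDerivAt
  have hhess : hessS φ x v w = ⟪fderiv ℝ (gradient φ) x v, w⟫ := by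
    have h1 : (fun y => covD φ y w) =ᶠ[nhds x] fun y => ⟪gradient φ y, w⟫ := by
      filter_upwards [hev] with y hy
      rw [covD_eq_fderiv hφ hs hy, inner_gradient_eq_fderiv]
    rw [hessS, h1.fderiv_eq, tanProj_of_inner_eq_zero hv,
      (hg.inner ℝ (hasFDerivAt_const w x)).fderiv]
    simp
  have hgrad : gradS φ x = gradient φ x := by
    rw [gradS, tanProj_of_inner_eq_zero]
    rw [real_inner_comm, hφ.inner_gradient_self hs hx0]
  have hH : ⟪fderiv ℝ (gradient (coneExt φ)) x v, w⟫ =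
      φ x * ⟪v, w⟫ + ⟪fderiv ℝ (gradient φ) x v, w⟫ := by
    have h1 : gradient (coneExt φ) =ᶠ[nhds x]
        fun y => (φ y * ‖y‖⁻¹) • y + ‖y‖ • gradient φ y := by
      filter_upwards [hev] with y hy using hs.gradient_coneExt hy
    have h2 : DifferentiableAt ℝ (fun y => φ y * ‖y‖⁻¹) x :=
      (hs.differentiableAt hx0).fun_mul
        ((hasFDerivAt_norm_of_ne_zero hx0).differentiableAt.fun_inv (by simp [hx0]))
    have h3 : HasFDerivAt (fun y => (φ y * ‖y‖⁻¹) • y + ‖y‖ • gradient φ y) _ x :=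
      (h2.hasFDerivAt.fun_smul (hasFDerivAt_id x)).fun_add
        ((hasFDerivAt_norm_of_ne_zero hx0).fun_smul hg)
    rw [h1.fderiv_eq, h3.fderiv]
    simp [inner_add_left, inner_smul_left, hw, hv, hx1]
  rw [Aform, hhess, hgrad, hH, tanProj_of_inner_eq_zero hv, tanProj_of_inner_eq_zero hw,
    norm_gradient_coneExt_sq hφ hs hx0, coneExt, hx1]
  field_simp
  ring

end Cone

section Rigidity

variable {n : ℕ} {φ : Euc n → ℝ}

/-- At every point of the sphere there is an orthonormal frame in which `A[φ]` is diagonal. -/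
theorem exists_eigenframe (hφ : Homog0 φ) (hs : SmoothFn φ) (hpos : ∀ x ∈ uSphere n, 0 < φ x)
    (hconv : UnifHConvex φ) {x : Euc n} (hx : x ∈ uSphere n) :
    ∃ (b : OrthonormalBasis (Fin (n + 1)) ℝ (Euc n)) (l : Fin n → ℝ),
      fderiv ℝ (gradient (coneExt φ)) x (b 0) = 0 ∧
      (∀ i : Fin n, fderiv ℝ (gradient (coneExt φ)) x (b i.succ) =
        (l i + (‖gradient (coneExt φ) x‖ ^ 2 + 1) / (2 * φ x)) • b i.succ) ∧
      (∀ i, 0 < l i) ∧ OrthoFrame x (fun i => b i.succ) ∧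
      Amat φ x (fun i => b i.succ) = Matrix.diagonal l := by
  have hx0 := ne_zero_of_mem_uSphere hx
  have hx1 := norm_of_mem_uSphere hx
  have hφx := (hpos x hx).ne'
  have hC := hs.contDiffAt_coneExt hx0
  have hHx := fderiv_gradient_apply_self (coneExt_smul hφ) hC
  obtain ⟨b, h, hb0, hb⟩ := exists_orthonormalBasis_eigenvectors (n := n) (by simp)
    (inner_fderiv_gradient_comm hC) hx1 hHx
  have hframe : OrthoFrame x (fun i => b i.succ) := by
    refine ⟨fun i => ?_, fun i j => ?_⟩
    · rw [← hb0, b.inner_eq_ite, if_neg (Fin.succ_ne_zero i).symm]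
    · simp [b.inner_eq_ite]
  set q := (‖gradient (coneExt φ) x‖ ^ 2 + 1) / (2 * φ x) with hq
  have hA : Amat φ x (fun i => b i.succ) = Matrix.diagonal fun i => h i - q := by
    ext i j
    rw [Amat, Matrix.of_apply, Aform_eq_inner hφ hs hx (hframe.1 i) (hframe.1 j) hφx, hb,
      inner_smul_left, hframe.2, Matrix.diagonal_apply, coneExt, hx1, one_mul, ← hq]
    split_ifs <;> simp
  refine ⟨b, fun i => h i - q, by rw [hb0, hHx], fun i => by simp [hb], fun i => ?_, hframe, hA⟩
  have h1 := hconv x hx (b i.succ) (hframe.1 i) (b.orthonormal.ne_zero i.succ)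
  have h2 := congrFun (congrFun hA i) i
  rw [Matrix.diagonal_apply_eq] at h2
  exact h1.trans_eq h2

theorem inv_norm_smul_mem_uSphere {y : Euc n} (hy : y ≠ 0) : ‖y‖⁻¹ • y ∈ uSphere n := by
  rw [uSphere, mem_sphere_zero_iff_norm, norm_smul, norm_inv, norm_norm,
    inv_mul_cancel₀ (norm_ne_zero_iff.mpr hy)]

theorem shiftCoeff_coneExt_pos {s : ℝ} (hφ : Homog0 φ) (hpos : ∀ x ∈ uSphere n, 0 < φ x)
    (hR : ∀ x ∈ uSphere n, ‖gradient (coneExt φ) x‖ ^ 2 < s) {y : Euc n} (hy : y ≠ 0) :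
    0 < shiftCoeff (coneExt φ) s y := by
  have hy' : 0 < ‖y‖ := norm_pos_iff.mpr hy
  have h := hR _ (inv_norm_smul_mem_uSphere hy)
  rw [gradient_smul_of_homogeneous (coneExt_smul hφ) (inv_pos.mpr hy')] at h
  exact div_pos (sub_pos.mpr h) (mul_pos two_pos (mul_pos hy' (hφ.pos hpos hy)))

theorem add_shiftCoeff_coneExt {s : ℝ} {x : Euc n} (hx : x ∈ uSphere n) (l : ℝ) :
    l + (‖gradient (coneExt φ) x‖ ^ 2 + 1) / (2 * φ x) + shiftCoeff (coneExt φ) s x =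
      l + (s + 1) / 2 * (φ x)⁻¹ := by
  rw [shiftCoeff, coneExt, norm_of_mem_uSphere hx]
  ring

theorem isUnit_shiftedHess_coneExt {s : ℝ} (hφ : Homog0 φ) (hs : SmoothFn φ)
    (hpos : ∀ x ∈ uSphere n, 0 < φ x) (hconv : UnifHConvex φ)
    (hR : ∀ x ∈ uSphere n, ‖gradient (coneExt φ) x‖ ^ 2 < s) {y : Euc n} (hy : y ≠ 0) :
    IsUnit (shiftedHess (coneExt φ) s y) := by
  have hy' : 0 < ‖y‖ := norm_pos_iff.mpr hy
  have hx := inv_norm_smul_mem_uSphere hy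
  have hsp : 0 < s := (sq_nonneg _).trans_lt (hR _ hx)
  obtain ⟨b, l, hb0, hb, hl, -, -⟩ := exists_eigenframe hφ hs hpos hconv hx
  set x := ‖y‖⁻¹ • y with hxy
  have hν := shiftCoeff_coneExt_pos hφ hpos hR (ne_zero_of_mem_uSphere hx)
  have hM : ∀ i, shiftedHess (coneExt φ) s x (b i) = (Fin.cons (shiftCoeff (coneExt φ) s x)
      (fun i => l i + (s + 1) / 2 * (φ x)⁻¹) : Fin (n + 1) → ℝ) i • b i := by
    intro i
    have h : shiftedHess (coneExt φ) s x (b i) = fderiv ℝ (gradient (coneExt φ)) x (b i) +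
      shiftCoeff (coneExt φ) s x • b i := rfl
    rw [h]
    refine Fin.cases ?_ (fun i => ?_) i
    · simp [hb0]
    · rw [hb, ← add_smul, add_shiftCoeff_coneExt hx, Fin.cons_succ]
  have hu := isUnit_of_orthonormalBasis hM (Fin.cases hν.ne' fun i => by
    have := hl i
    have := hpos x hx
    rw [Fin.cons_succ]
    positivity)
  have hyx : y = ‖y‖ • x := by rw [hxy, smul_inv_smul₀ hy'.ne']
  rw [hyx, shiftedHess_smul_of_homogeneous (coneExt_smul hφ) s hy']
  exact isUnit_smul_of_ne_zero (inv_ne_zero hy'.ne') hu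

/-- The linear combination of divergences of cofactor fields that extracts a Newton operator. -/
theorem sum_basis_coeff_mul_dvg_cofactorField_le [NeZero n] {k : ℕ} (hk : k + 1 ≤ n)
    {v : Fin n → ℝ} (hv : Function.Injective v) (hφ : Homog0 φ) (hs : SmoothFn φ)
    (hpos : ∀ x ∈ uSphere n, 0 < φ x) (hconv : UnifHConvex φ)
    (hR : ∀ j, ∀ x ∈ uSphere n, ‖gradient (coneExt φ) x‖ ^ 2 < 2 * v j - 1)
    {f : Euc n → ℝ} {p : ℝ} (hsol : SolvesCM n k p f φ) {x : Euc n} (hx : x ∈ uSphere n) :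
    ∑ j, (Lagrange.basis univ v j).coeff (n - 1 - k) *
        dvg (cofactorField (coneExt φ) (2 * v j - 1)) x ≤
      (φ x ^ (n - k))⁻¹ * (((n : ℝ) - k) / n * (φ x ^ (p - k) * f x) *
        (dvg (gradient (coneExt φ)) x - n * (‖gradient (coneExt φ) x‖ ^ 2 / φ x))) := by
  have hx0 := ne_zero_of_mem_uSphere hx
  have hx1 := norm_of_mem_uSphere hx
  have hφx := hpos x hx
  have hΦx : coneExt φ x = φ x := by rw [coneExt, hx1, one_mul]
  obtain ⟨b, l, hb0, hb, hl, hframe, hA⟩ := exists_eigenframe hφ hs hpos hconv hx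
  have hσ := hsol x hx _ hframe
  rw [hA, sigmaMat_diagonal] at hσ
  set G := ‖gradient (coneExt φ) x‖ ^ 2 with hG
  have hdvg : ∀ j, dvg (cofactorField (coneExt φ) (2 * v j - 1)) x = (φ x)⁻¹ *
      ∑ i, (l i - (G - 1) / (2 * φ x)) * ∏ m ∈ univ.erase i, (l m + v j * (φ x)⁻¹) := by
    intro j
    have hν := shiftCoeff_coneExt_pos hφ hpos (hR j) hx0
    have hvj : 0 < v j := by nlinarith [hR j x hx, sq_nonneg ‖gradient (coneExt φ) x‖]
    have hβ : ∀ i, l i + (G + 1) / (2 * φ x) + shiftCoeff (coneExt φ) (2 * v j - 1) x =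
        l i + v j * (φ x)⁻¹ := fun i => by
      rw [add_shiftCoeff_coneExt hx]
      ring
    rw [dvg_cofactorField_eq_sum (hs.contDiffAt_coneExt hx0) (hΦx.trans_ne hφx.ne') hν.ne' hb0 hb
      (fun i => by rw [hβ]; have := hl i; positivity), hΦx, ← hG]
    simp_rw [hβ]
    congr 1
    refine Finset.sum_congr rfl fun i _ => ?_
    congr 1
    field_simp
    ring
  have htr : dvg (gradient (coneExt φ)) x = ∑ i, (l i + (G + 1) / (2 * φ x)) := by
    have h : ∀ i, fderiv ℝ (gradient (coneExt φ)) x (b i) = (Fin.cons 0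
        (fun i => l i + (G + 1) / (2 * φ x)) : Fin (n + 1) → ℝ) i • b i :=
      Fin.cases (by simp [hb0]) fun i => by rw [hb, Fin.cons_succ]
    rw [dvg, trace_eq_sum_of_orthonormalBasis h, Fin.sum_univ_succ]
    simp
  have hcheb := sum_sub_mul_punctEsymm_le (fun i => (hl i).le) (k := k)
    (by rw [Fintype.card_fin]; omega) ((G - 1) / (2 * φ x))
  rw [Fintype.card_fin, hσ] at hcheb
  have hsum := sum_basis_coeff_mul_sum_prod hk hv l (fun i => l i - (G - 1) / (2 * φ x)) (φ x)⁻¹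
  calc _ = (φ x)⁻¹ * ((φ x)⁻¹ ^ (n - 1 - k) *
        ∑ i, (l i - (G - 1) / (2 * φ x)) * punctEsymm l k i) := by
        rw [← hsum, Finset.mul_sum]
        refine Finset.sum_congr rfl fun j _ => ?_
        rw [hdvg]
        ring
    _ = (φ x ^ (n - k))⁻¹ * ∑ i, (l i - (G - 1) / (2 * φ x)) * punctEsymm l k i := by
        rw [← mul_assoc, ← pow_succ', inv_pow, show n - 1 - k + 1 = n - k by omega]
    _ ≤ (φ x ^ (n - k))⁻¹ * _ := mul_le_mul_of_nonneg_left hcheb (by positivity)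
    _ = _ := by
        rw [htr, Finset.sum_add_distrib, Finset.sum_const, card_univ, Fintype.card_fin,
          nsmul_eq_mul]
        congr 2
        field_simp
        ring

/-- The field `φ ^ m / Φ ^ n • ∇Φ`, where `Φ` is the 1-homogeneous extension of `φ`. -/
def weightedGradient (m : ℕ) (φ : Euc n → ℝ) (y : Euc n) : Euc n :=
  (φ y ^ m * (coneExt φ y ^ n)⁻¹) • gradient (coneExt φ) y

theorem weightedGradient_smul (hφ : Homog0 φ) (m : ℕ) {c : ℝ} (hc : 0 < c) (y : Euc n) :
    weightedGradient m φ (c • y) = (c ^ n)⁻¹ • weightedGradient m φ y := by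
  rw [weightedGradient, weightedGradient, gradient_smul_of_homogeneous (coneExt_smul hφ) hc,
    hφ c y hc, coneExt_smul hφ c y hc, smul_smul, mul_pow, mul_inv]
  congr 1
  ring

theorem contDiffAt_weightedGradient (hφ : Homog0 φ) (hs : SmoothFn φ)
    (hpos : ∀ x ∈ uSphere n, 0 < φ x) (m : ℕ) {y : Euc n} (hy : y ≠ 0) :
    ContDiffAt ℝ (⊤ : ℕ∞) (weightedGradient m φ) y := by
  have hC := hs.contDiffAt_coneExt hy
  have h0 : coneExt φ y ≠ 0 := mul_ne_zero (norm_ne_zero_iff.mpr hy) (hφ.pos hpos hy).ne'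
  exact (((hs.contDiffAt hy).pow m).mul ((hC.pow n).inv (pow_ne_zero n h0))).smul
    (hC.gradient' (by simp))

theorem dvg_weightedGradient (hφ : Homog0 φ) (hs : SmoothFn φ)
    (hpos : ∀ x ∈ uSphere n, 0 < φ x) (m : ℕ) {x : Euc n} (hx : x ∈ uSphere n) :
    dvg (weightedGradient m φ) x =
      φ x ^ m * (φ x ^ n)⁻¹ * (dvg (gradient (coneExt φ)) x -
        n * (‖gradient (coneExt φ) x‖ ^ 2 / φ x)) +
      m * φ x ^ (m - 1) * (φ x ^ n)⁻¹ * ‖gradient φ x‖ ^ 2 := by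
  have hx0 := ne_zero_of_mem_uSphere hx
  have hx1 := norm_of_mem_uSphere hx
  have hφx := (hpos x hx).ne'
  have hΦx : coneExt φ x = φ x := by rw [coneExt, hx1, one_mul]
  have hC := hs.contDiffAt_coneExt hx0
  have hΦd := (hC.differentiableAt (by simp)).hasFDerivAt
  have ha : HasFDerivAt (fun y => φ y ^ m * (coneExt φ y ^ n)⁻¹) _ x :=
    ((hs.differentiableAt hx0).hasFDerivAt.pow m).fun_mul
      ((hasDerivAt_inv (pow_ne_zero n (hΦx.trans_ne hφx))).comp_hasFDerivAt x (hΦd.pow n))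
  have hg : DifferentiableAt ℝ (gradient (coneExt φ)) x :=
    (hC.gradient' (m := ⊤) (by simp)).differentiableAt (by simp)
  have h : weightedGradient m φ =
    fun y => (φ y ^ m * (coneExt φ y ^ n)⁻¹) • gradient (coneExt φ) y := rfl
  rw [h, dvg_smul ha.differentiableAt hg, ha.fderiv]
  simp only [add_apply, smul_apply, smul_eq_mul, ← inner_gradient_eq_fderiv,
    inner_gradient_gradient_coneExt hφ hs hx0, real_inner_self_eq_norm_sq, hΦx, hx1]
  rcases Nat.eq_zero_or_pos n with hn | hn
  · subst hn
    simp [add_comm]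
  · obtain ⟨n', rfl⟩ := Nat.exists_eq_add_of_lt hn
    simp
    field_simp
    ring

theorem exists_norm_gradient_coneExt_sq_le (hs : SmoothFn φ) :
    ∃ R : ℝ, ∀ x ∈ uSphere n, ‖gradient (coneExt φ) x‖ ^ 2 ≤ R := by
  have hc : ContinuousOn (fun x => ‖gradient (coneExt φ) x‖ ^ 2) (uSphere n) := fun x hx =>
    (((hs.contDiffAt_coneExt (ne_zero_of_mem_uSphere hx)).gradient' (m := ⊤)
      (by simp)).continuousAt.norm.pow 2).continuousWithinAt
  obtain ⟨R, hR⟩ := (isCompact_sphere (0 : Euc n) 1).bddAbove_image hc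
  exact ⟨R, fun x hx => hR ⟨x, hx, rfl⟩⟩

/-- Uniformly h-convex solutions for constant data and exponent `2k` have vanishing gradient. -/
theorem gradient_eq_zero_of_solvesCM {k : ℕ} (hk1 : 1 ≤ k) (hk : k + 1 ≤ n) {γ : ℝ} (hγ : 0 < γ)
    (hφ : Homog0 φ) (hs : SmoothFn φ) (hpos : ∀ x ∈ uSphere n, 0 < φ x)
    (hconv : UnifHConvex φ) (hsol : SolvesCM n k (2 * (k : ℝ)) (fun _ => γ) φ)
    {x : Euc n} (hx : x ∈ uSphere n) : gradient φ x = 0 := by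
  have _ : NeZero n := ⟨by omega⟩
  obtain ⟨R, hR⟩ := exists_norm_gradient_coneExt_sq_le hs
  have hR0 : 0 ≤ R := (sq_nonneg _).trans (hR x hx)
  let v : Fin n → ℝ := fun j => R + 1 + (j : ℕ)
  have hv : Function.Injective v := fun i j hij => by simpa [v, Fin.ext_iff] using hij
  have hvR : ∀ j, ∀ x ∈ uSphere n, ‖gradient (coneExt φ) x‖ ^ 2 < 2 * v j - 1 := by
    intro j x hx
    have := hR x hx
    have : (0 : ℝ) ≤ (j : ℕ) := Nat.cast_nonneg _
    simp only [v]
    linarith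
  have hkn : (k : ℝ) + 1 ≤ n := by exact_mod_cast hk
  have hn0 : (0 : ℝ) < n := by linarith [(Nat.cast_nonneg k : (0 : ℝ) ≤ k)]
  let K : ℝ := ((n : ℝ) - k) / n * γ
  have hK : 0 < K := mul_pos (div_pos (by linarith) hn0) hγ
  let c : Fin n → ℝ := fun j => (Lagrange.basis univ v j).coeff (n - 1 - k)
  let Z : Euc n → Euc n := fun y => K • weightedGradient (2 * k) φ y -
    ∑ j, c j • cofactorField (coneExt φ) (2 * v j - 1) y
  have hcof : ∀ j, ∀ y : Euc n, y ≠ 0 →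
      ContDiffAt ℝ (⊤ : ℕ∞) (cofactorField (coneExt φ) (2 * v j - 1)) y := fun j y hy =>
    (hs.contDiffAt_coneExt hy).cofactorField
      (mul_ne_zero (norm_ne_zero_iff.mpr hy) (hφ.pos hpos hy).ne')
      (shiftCoeff_coneExt_pos hφ hpos (hvR j) hy).ne'
      (isUnit_shiftedHess_coneExt hφ hs hpos hconv (hvR j) hy)
  have hw : ∀ y : Euc n, y ≠ 0 → ContDiffAt ℝ (⊤ : ℕ∞) (weightedGradient (2 * k) φ) y :=
    fun y hy => contDiffAt_weightedGradient hφ hs hpos _ hy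
  have hZ : ∀ y : Euc n, y ≠ 0 → ContDiffAt ℝ (⊤ : ℕ∞) Z y := fun y hy =>
    ((hw y hy).const_smul K).sub (ContDiffAt.sum fun j _ => (hcof j y hy).const_smul (c j))
  have hZhom : ∀ (r : ℝ) (y : Euc n), 0 < r → Z (r • y) = (r ^ n)⁻¹ • Z y := by
    intro r y hr
    simp only [Z, weightedGradient_smul hφ _ hr,
      cofactorField_smul_of_homogeneous (n := n) (by simp) (coneExt_smul hφ) _ hr, smul_sub,
      Finset.smul_sum, smul_comm (r ^ n)⁻¹]
  have hZdvg : ∀ x ∈ uSphere n,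
      K * ((2 * k : ℕ) * φ x ^ (2 * k - 1) * (φ x ^ n)⁻¹ * ‖gradient φ x‖ ^ 2) ≤ dvg Z x := by
    intro x hx
    have hx0 := ne_zero_of_mem_uSphere hx
    have hφx := hpos x hx
    have htop : ((⊤ : ℕ∞) : WithTop ℕ∞) ≠ 0 := by simp
    have hle := sum_basis_coeff_mul_dvg_cofactorField_le hk hv hφ hs hpos hconv hvR hsol hx
    have hcd := fun j => (hcof j x hx0).differentiableAt htop
    have hwd := (hw x hx0).differentiableAt htop
    rw [dvg_sub (hwd.fun_const_smul K)
        (DifferentiableAt.fun_sum fun j _ => (hcd j).fun_const_smul (c j)),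
      dvg_sum fun j _ => (hcd j).fun_const_smul (c j), dvg_const_smul K hwd,
      dvg_weightedGradient hφ hs hpos _ hx]
    simp_rw [fun j => dvg_const_smul (c j) (hcd j)]
    refine le_sub_iff_add_le.mpr ((add_le_add_right hle _).trans_eq ?_)
    have hpow : φ x ^ (2 * (k : ℝ) - k) = φ x ^ k := by
      rw [← Real.rpow_natCast]
      congr 1
      ring
    have hnk : (φ x ^ (n - k))⁻¹ = φ x ^ k * (φ x ^ n)⁻¹ := by
      rw [← Nat.sub_add_cancel (show k ≤ n by omega), Nat.add_sub_cancel, pow_add]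
      field_simp
    rw [hpow, hnk]
    simp only [K]
    ring
  have hterm : ∀ x ∈ uSphere n, 0 ≤ (2 * k : ℕ) * φ x ^ (2 * k - 1) * (φ x ^ n)⁻¹ := fun x hx => by
    have := hpos x hx
    positivity
  have h0 := dvg_eq_zero_of_nonneg (n := n) (by simp)
    (fun y hy => ((hZ y hy).of_le (by exact_mod_cast le_top)).contDiffWithinAt) hZhom
    (fun y hy => (mul_nonneg hK.le (mul_nonneg (hterm y (mem_sphere_zero_iff_norm.mpr hy))
      (sq_nonneg _))).trans (hZdvg y (mem_sphere_zero_iff_norm.mpr hy)))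
    (norm_of_mem_uSphere hx)
  have h1 := hZdvg x hx
  rw [h0] at h1
  have hφx := hpos x hx
  have hk0 : 0 < 2 * k := by omega
  by_contra hne
  have : 0 < ‖gradient φ x‖ := norm_pos_iff.mpr hne
  exact absurd h1 (not_le.mpr (by positivity))

theorem eq_of_gradient_eq_zero (hn : 1 ≤ n) (hφ : Homog0 φ) (hs : SmoothFn φ)
    (h : ∀ x ∈ uSphere n, gradient φ x = 0) {y z : Euc n} (hy : y ≠ 0) (hz : z ≠ 0) :
    φ y = φ z := by
  have hconn : IsPreconnected {y : Euc n | y ≠ 0} :=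
    (isConnected_compl_singleton_of_one_lt_rank (by
      rw [← Module.finrank_eq_rank, finrank_euclideanSpace_fin]
      exact_mod_cast Nat.lt_succ_of_le hn) (0 : Euc n)).isPreconnected
  refine isOpen_ne.is_const_of_fderiv_eq_zero hconn
    (fun y hy => (hs.differentiableAt hy).differentiableWithinAt) (fun y hy => ?_) hy hz
  have hy' : ‖y‖⁻¹ ≠ 0 := inv_ne_zero (norm_ne_zero_iff.mpr hy)
  have h1 := fderiv_smul_of_homogeneous (f := φ) (r := 1) hy' (fun z => by
    rw [hφ _ z (by positivity), one_smul]) y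
  have h2 : fderiv ℝ φ (‖y‖⁻¹ • y) = 0 := by
    ext v
    rw [← inner_gradient_eq_fderiv, h _ (inv_norm_smul_mem_uSphere hy), inner_zero_left]
    rfl
  rw [h2] at h1
  exact (smul_eq_zero.mp h1.symm).resolve_left (by positivity)

theorem Aform_congr {ψ : Euc n → ℝ} {x : Euc n} (h : φ =ᶠ[nhds x] ψ) (v w : Euc n) :
    Aform φ x v w = Aform ψ x v w := by
  have h1 : (fun y => covD φ y w) =ᶠ[nhds x] fun y => covD ψ y w := by
    filter_upwards [h.fderiv (𝕜 := ℝ)] with y hy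
    rw [covD, covD, hy]
  rw [Aform, Aform, hessS, hessS, h1.fderiv_eq, h.eq_of_nhds, gradS, gradS, gradient, gradient,
    h.fderiv_eq]

theorem Aform_const (c : ℝ) (x v w : Euc n) :
    Aform (fun _ => c) x v w = (c - c⁻¹) / 2 * ⟪tanProj x v, tanProj x w⟫ := by
  simp [Aform, hessS, covD, gradS, gradient, tanProj]

theorem sigmaMat_Amat_const {k : ℕ} (c : ℝ) {x : Euc n} {e : Fin n → Euc n}
    (he : OrthoFrame x e) :
    sigmaMat k (Amat (fun _ => c) x e) = n.choose k * ((c - c⁻¹) / 2) ^ k := by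
  have h : Amat (fun _ => c) x e = Matrix.diagonal fun _ => (c - c⁻¹) / 2 := by
    ext i j
    rw [Amat, Matrix.of_apply, Aform_const, tanProj_of_inner_eq_zero (he.1 i),
      tanProj_of_inner_eq_zero (he.1 j), he.2, Matrix.diagonal_apply, mul_ite, mul_one, mul_zero]
  rw [h, sigmaMat_diagonal, Finset.sum_congr rfl fun t ht => by
    rw [Finset.prod_const, (mem_powersetCard.mp ht).2]]
  simp

end Rigidity

/-- The positive constant `c` with `(c - 1 / c) / 2 = q * c`. -/
theorem exists_one_lt_sub_inv_div_two_eq {q : ℝ} (hq0 : 0 < q) (hq1 : q < 1 / 2) :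
    ∃ c : ℝ, 1 < c ∧ (c - c⁻¹) / 2 = q * c ∧
      ∀ d : ℝ, 0 < d → (d - d⁻¹) / 2 = q * d → d = c := by
  have h : ∀ d : ℝ, 0 < d → ((d - d⁻¹) / 2 = q * d ↔ d ^ 2 = (1 - 2 * q)⁻¹) := by
    intro d hd
    have : 1 - 2 * q ≠ 0 := by linarith
    field_simp
    constructor <;> intro h <;> linarith
  have hr : 1 < (1 - 2 * q)⁻¹ := (one_lt_inv₀ (by linarith)).mpr (by linarith)
  have hc : 1 < √((1 - 2 * q)⁻¹) := by rwa [Real.lt_sqrt zero_le_one, one_pow]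
  refine ⟨_, hc, (h _ (by linarith)).mpr (Real.sq_sqrt (by linarith)), fun d hd hdq => ?_⟩
  rw [← (h d hd).mp hdq, Real.sqrt_sq hd.le]

theorem exists_pow_mul_choose_eq {n k : ℕ} {γ : ℝ} (hk : k ≠ 0) (hkn : k ≤ n) (hγ0 : 0 < γ)
    (hγ1 : γ < (n.choose k : ℝ) / 2 ^ k) :
    ∃ q : ℝ, 0 < q ∧ q < 1 / 2 ∧ n.choose k * q ^ k = γ := by
  have hC : (0 : ℝ) < n.choose k := by exact_mod_cast Nat.choose_pos hkn
  have hpos : 0 < γ / n.choose k := div_pos hγ0 hC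
  have hq : ((γ / n.choose k) ^ (k : ℝ)⁻¹) ^ k = γ / n.choose k :=
    Real.rpow_inv_natCast_pow hpos.le hk
  refine ⟨(γ / n.choose k) ^ (k : ℝ)⁻¹, by positivity, ?_, by rw [hq]; field_simp⟩
  refine lt_of_pow_lt_pow_left₀ k (by norm_num) ?_
  rw [hq, div_lt_iff₀ hC, one_div, inv_pow, ← div_eq_inv_mul]
  exact hγ1

/-- **Uniqueness of constant solutions, case `p = 2k`** (Lemma 5.1(2) of Luo–Wei):
for each constant `γ` with `0 < γ < C(n,k)/2^k` the equation `σ_k(A[φ]) = φ^{p-k} γ` with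
`p = 2k` has a unique even, uniformly h-convex solution, namely a constant `φ = c > 1`. -/
theorem constant_solution_p_eq_two_k (n k : ℕ) (γ : ℝ)
    (hn : 2 ≤ n) (hk1 : 1 ≤ k) (hk2 : k ≤ n - 1)
    (hγ0 : 0 < γ) (hγ1 : γ < (n.choose k : ℝ) / 2 ^ k) :
    ∃ c : ℝ, 1 < c ∧
      UnifHConvex (fun _ : Euc n => c) ∧
      SolvesCM n k (2 * (k : ℝ)) (fun _ => γ) (fun _ => c) ∧
      ∀ φ : Euc n → ℝ, Homog0 φ → SmoothFn φ → EvenFn φ →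
        (∀ x ∈ uSphere n, 0 < φ x) → UnifHConvex φ →
        SolvesCM n k (2 * (k : ℝ)) (fun _ => γ) φ →
        ∀ x ∈ uSphere n, φ x = c := by
  obtain ⟨q, hq0, hq1, hqγ⟩ := exists_pow_mul_choose_eq (by omega) (by omega) hγ0 hγ1
  obtain ⟨c, hc1, hcq, huniq⟩ := exists_one_lt_sub_inv_div_two_eq hq0 hq1
  have hpow : ∀ d : ℝ, d ^ (2 * (k : ℝ) - k) = d ^ k := fun d => by
    rw [← Real.rpow_natCast]
    congr 1
    ring
  refine ⟨c, hc1, fun x _ v hv hv0 => ?_, fun x _ e he => ?_, ?_⟩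
  · rw [Aform_const, tanProj_of_inner_eq_zero hv, hcq, real_inner_self_eq_norm_sq]
    have := norm_pos_iff.mpr hv0
    positivity
  · rw [sigmaMat_Amat_const c he, hcq, hpow, ← hqγ, mul_pow]
    ring
  · intro φ hφ hs _ hpos hconv hsol x hx
    have hx0 := ne_zero_of_mem_uSphere hx
    have hd := hpos x hx
    have hev : φ =ᶠ[nhds x] fun _ => φ x := by
      filter_upwards [isOpen_ne.mem_nhds hx0] with y hy
      exact eq_of_gradient_eq_zero (by omega) hφ hs (fun x hx =>
        gradient_eq_zero_of_solvesCM hk1 (by omega) hγ0 hφ hs hpos hconv hsol hx) hy hx0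
    obtain ⟨b, l, -, -, hl, hframe, hA⟩ := exists_eigenframe hφ hs hpos hconv hx
    have hAc : Amat φ x (fun i => b i.succ) = Amat (fun _ => φ x) x fun i => b i.succ := by
      ext i j
      exact Aform_congr hev _ _
    have hpos' : 0 < (φ x - (φ x)⁻¹) / 2 := by
      have h := congrFun (congrFun hA ⟨0, by omega⟩) ⟨0, by omega⟩
      rw [hAc, Matrix.diagonal_apply_eq, Amat, Matrix.of_apply, Aform_const,
        tanProj_of_inner_eq_zero (hframe.1 _), hframe.2, if_pos rfl, mul_one] at h
      rw [h]
      exact hl _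
    have hσ := hsol x hx _ hframe
    rw [hAc, sigmaMat_Amat_const _ hframe, hpow, ← hqγ, mul_left_comm, ← mul_pow,
      mul_comm (φ x)] at hσ
    have hC : (n.choose k : ℝ) ≠ 0 := by exact_mod_cast (Nat.choose_pos (by omega)).ne'
    exact huniq _ hd ((pow_left_inj₀ hpos'.le (by positivity) (by omega)).mp
      (mul_left_cancel₀ hC hσ))
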